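/- There does not exist a smooth (nonsingular) real algebraic Levi-flat hypersurface in CP^n, n ≥ 2; that is, no closed smooth Levi-flat hypersurface in CP^n arises as the closure in CP^n of the zero locus in C^n of a real polynomial P(z, z̄) with nonvanishing gradient. -/

import Mathlib

/- STATEMENT 13: There does not exist a smooth (nonsingular) real algebraic Levi-flat
hypersurface in ℂℙⁿ, n ≥ 2: no closed smooth Levi-flat hypersurface in ℂℙⁿ arises as the
closure in ℂℙⁿ of the zero locus in ℂⁿ of a real polynomial P(z, z̄) with nonvanishing
gradient.

ℂⁿ sits inside ℂℙⁿ as the affine chart {z₀ ≠ 0}; subsets of ℂℙⁿ are encoded by cones in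
ℂ^{n+1} ∖ {0}.  A real polynomial in z, z̄ on ℂⁿ is encoded as a real polynomial in the
real and imaginary parts of the coordinates (variables indexed by `Fin n ⊕ Fin n`). -/

open Complex Set

noncomputable section

/-- The Levi form (up to a positive factor) of the defining function `ρ` at `p`,
evaluated at `w`: `D²ρ(p)(w,w) + D²ρ(p)(Jw,Jw) = 4 ∑ ∂²ρ/∂zⱼ∂z̄ₖ wⱼ w̄ₖ`. -/
def leviForm {m : ℕ} (ρ : (Fin m → ℂ) → ℝ) (p w : Fin m → ℂ) : ℝ :=
  iteratedFDeriv ℝ 2 ρ p ![w, w] + iteratedFDeriv ℝ 2 ρ p ![Complex.I • w, Complex.I • w]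

/-- `w` belongs to the complex tangent space at `p` of the hypersurface `{ρ = 0}`. -/
def IsComplexTangent {m : ℕ} (ρ : (Fin m → ℂ) → ℝ) (p w : Fin m → ℂ) : Prop :=
  fderiv ℝ ρ p w = 0 ∧ fderiv ℝ ρ p (Complex.I • w) = 0

/-- `M` is a smooth (`C^∞`) Levi-flat real hypersurface: near each of its points it is
the zero set of a smooth defining function with nonvanishing gradient whose Levi form
vanishes identically on complex tangent vectors. -/
def IsSmoothLeviFlatHypersurface {m : ℕ} (M : Set (Fin m → ℂ)) : Prop :=
  ∀ p ∈ M, ∃ V : Set (Fin m → ℂ), IsOpen V ∧ p ∈ V ∧ ∃ ρ : (Fin m → ℂ) → ℝ,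
    (∀ k : ℕ, ContDiffOn ℝ k ρ V) ∧ (∀ q ∈ V, fderiv ℝ ρ q ≠ 0) ∧
    (∀ q ∈ V, q ∈ M ↔ ρ q = 0) ∧
    (∀ q ∈ V, ρ q = 0 → ∀ w, IsComplexTangent ρ q w → leviForm ρ q w = 0)

/-- `S` is a cone: it is invariant under multiplication by nonzero complex scalars.
Subsets of `ℂℙⁿ` are encoded by the cones over them in `ℂ^{n+1} ∖ {0}`. -/
def IsCone {m : ℕ} (S : Set (Fin m → ℂ)) : Prop :=
  ∀ c : ℂ, c ≠ 0 → ∀ z ∈ S, c • z ∈ S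

/-- The cone `S ⊆ ℂ^{n+1} ∖ {0}` represents a closed (= compact) subset of `ℂℙⁿ`:
it is closed in the punctured space `ℂ^{n+1} ∖ {0}`. -/
def IsClosedInPunctured {m : ℕ} (S : Set (Fin m → ℂ)) : Prop :=
  ∀ z ∈ closure S, z ≠ 0 → z ∈ S

/-- The cone over a closed subset of `ℂℙⁿ`. -/
def IsProjectiveClosedSet {m : ℕ} (S : Set (Fin m → ℂ)) : Prop :=
  S.Nonempty ∧ (∀ z ∈ S, z ≠ 0) ∧ IsCone S ∧ IsClosedInPunctured S

/-- Evaluation of a real polynomial in `Re z₁, …, Re zₙ, Im z₁, …, Im zₙ` at `z ∈ ℂⁿ`. -/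
def realPolyEval {n : ℕ} (P : MvPolynomial (Fin n ⊕ Fin n) ℝ) (z : Fin n → ℂ) : ℝ :=
  MvPolynomial.eval (Sum.elim (fun i => (z i).re) (fun i => (z i).im)) P

/-- The cone in `ℂ^{n+1} ∖ {0}` over the affine real algebraic set `{P = 0} ⊆ ℂⁿ`,
placed in the chart `{z₀ ≠ 0}` of `ℂℙⁿ`. -/
def affineAlgebraicCone {n : ℕ} (P : MvPolynomial (Fin n ⊕ Fin n) ℝ) :
    Set (Fin (n + 1) → ℂ) :=
  {w | w ≠ 0 ∧ w 0 ≠ 0 ∧ realPolyEval P (fun i => w i.succ / w 0) = 0}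

section LineSubstitution

open MvPolynomial

variable {σ : Type*}

/-- The substitution `f(y) ↦ f(y + w v)`, as a polynomial in `w` over the polynomials in `y`. -/
def lineSubst (v : σ → ℂ) : MvPolynomial σ ℂ →ₐ[ℂ] Polynomial (MvPolynomial σ ℂ) :=
  aeval fun i => Polynomial.C (X i) + Polynomial.X * Polynomial.C (C (v i))

/-- The automorphism of `ℂ[y][w]` extending `lineSubst v` and fixing `w`. -/
def lineShift (v : σ → ℂ) : Polynomial (MvPolynomial σ ℂ) →+* Polynomial (MvPolynomial σ ℂ) :=
  Polynomial.eval₂RingHom (lineSubst v).toRingHom Polynomial.X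

theorem lineShift_C (v : σ → ℂ) (f : MvPolynomial σ ℂ) :
    lineShift v (Polynomial.C f) = lineSubst v f := by
  simp [lineShift]

theorem lineShift_comp (v w : σ → ℂ) (h : v + w = 0) :
    (lineShift v).comp (lineShift w) = RingHom.id _ := by
  have hi : ∀ i, w i = - v i := fun i => by
    have := congrFun h i
    simp only [Pi.add_apply, Pi.zero_apply] at this
    linear_combination this
  refine Polynomial.ringHom_ext' (MvPolynomial.ringHom_ext ?_ ?_) ?_
  · intro r
    simp [lineShift, lineSubst]
  · intro i
    simp [lineShift, lineSubst, hi]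
    ring
  · simp [lineShift]

/-- `lineShift v` as a ring automorphism. -/
def lineShiftEquiv (v : σ → ℂ) : Polynomial (MvPolynomial σ ℂ) ≃+* Polynomial (MvPolynomial σ ℂ) :=
  RingEquiv.ofRingHom (lineShift v) (lineShift (-v)) (lineShift_comp _ _ (by simp))
    (lineShift_comp _ _ (by simp))

theorem lineShiftEquiv_C (v : σ → ℂ) (f : MvPolynomial σ ℂ) :
    lineShiftEquiv v (Polynomial.C f) = lineSubst v f := lineShift_C v f

theorem irreducible_lineSubst {f : MvPolynomial σ ℂ} (hf : Irreducible f) (v : σ → ℂ) :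
    Irreducible (lineSubst v f) := by
  rw [← lineShiftEquiv_C]
  exact (MulEquiv.irreducible_iff (lineShiftEquiv v)).2
    ((Polynomial.prime_C_iff.2 hf.prime).irreducible)

theorem dvd_of_lineSubst_dvd {f g : MvPolynomial σ ℂ} {v : σ → ℂ}
    (h : lineSubst v f ∣ lineSubst v g) : f ∣ g := by
  rw [← lineShiftEquiv_C, ← lineShiftEquiv_C, map_dvd_iff] at h
  have := (Polynomial.C_dvd_iff_dvd_coeff _ _).1 h 0
  simpa using this

theorem eval_map_lineSubst (v y : σ → ℂ) (w : ℂ) (f : MvPolynomial σ ℂ) :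
    ((lineSubst v f).map (eval y)).eval w = eval (y + w • v) f := by
  have : ((Polynomial.evalRingHom w).comp ((Polynomial.mapRingHom (eval y)).comp
      (lineSubst v).toRingHom)) = eval (y + w • v) := by
    refine MvPolynomial.ringHom_ext ?_ ?_
    · intro r; simp [lineSubst]
    · intro i; simp [lineSubst]; ring
  exact congrArg (fun φ => φ f) this

/-- The resultant of the restrictions of `f` and `g` to the lines with direction `v`. -/
def lineResultant (v : σ → ℂ) (f g : MvPolynomial σ ℂ) : MvPolynomial σ ℂ :=
  Polynomial.resultant (lineSubst v f) (lineSubst v g)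

theorem lineResultant_ne_zero_aux (K : Type*) [Field K] [Algebra (MvPolynomial σ ℂ) K]
    [IsFractionRing (MvPolynomial σ ℂ) K] {f g : MvPolynomial σ ℂ} (hf : Irreducible f)
    (hfg : ¬ f ∣ g) {v : σ → ℂ} (hdeg : (lineSubst v f).natDegree ≠ 0) :
    lineResultant v f g ≠ 0 := by
  intro h0
  have hinj : Function.Injective (algebraMap (MvPolynomial σ ℂ) K) := IsFractionRing.injective _ _
  have hprim : (lineSubst v f).IsPrimitive := (irreducible_lineSubst hf v).isPrimitive hdeg
  have hirr : Irreducible ((lineSubst v f).map (algebraMap (MvPolynomial σ ℂ) K)) :=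
    hprim.irreducible_iff_irreducible_map_fraction_map.1 (irreducible_lineSubst hf v)
  have h1 := congrArg (algebraMap (MvPolynomial σ ℂ) K) h0
  rw [lineResultant, ← Polynomial.resultant_map_map, map_zero,
    ← Polynomial.natDegree_map_eq_of_injective hinj (lineSubst v f),
    ← Polynomial.natDegree_map_eq_of_injective hinj (lineSubst v g),
    Polynomial.resultant_eq_zero_iff] at h1
  obtain ⟨q, hq⟩ := (hirr.isCoprime_or_dvd _).resolve_left h1.2
  have h3 : q ∈ Polynomial.lifts (algebraMap (MvPolynomial σ ℂ) K) := by
    rw [← hprim.map_mul_mem_lifts_iff, ← hq]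
    exact (Polynomial.mem_lifts _).2 ⟨_, rfl⟩
  obtain ⟨q', rfl⟩ := (Polynomial.mem_lifts _).1 h3
  rw [← Polynomial.map_mul] at hq
  exact hfg (dvd_of_lineSubst_dvd ⟨q', Polynomial.map_injective _ hinj hq⟩)

theorem lineResultant_ne_zero {f g : MvPolynomial σ ℂ} (hf : Irreducible f) (hfg : ¬ f ∣ g)
    {v : σ → ℂ} (hdeg : (lineSubst v f).natDegree ≠ 0) : lineResultant v f g ≠ 0 :=
  lineResultant_ne_zero_aux (FractionRing (MvPolynomial σ ℂ)) hf hfg hdeg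

theorem eval_lineResultant_eq_zero {f g : MvPolynomial σ ℂ} {v : σ → ℂ}
    (hdeg : (lineSubst v f).natDegree ≠ 0) {y : σ → ℂ} {w : ℂ}
    (hf : eval (y + w • v) f = 0) (hg : eval (y + w • v) g = 0) :
    eval y (lineResultant v f g) = 0 := by
  obtain ⟨p, q, -, -, h⟩ := Polynomial.exists_mul_add_mul_eq_C_resultant
    (lineSubst v f) (lineSubst v g) le_rfl le_rfl (Or.inl hdeg)
  have := congrArg (fun r => (r.map (eval y)).eval w) h
  simp only [Polynomial.map_add, Polynomial.map_mul, Polynomial.eval_add, Polynomial.eval_mul,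
    eval_map_lineSubst, hf, hg, zero_mul, zero_add, Polynomial.map_C, Polynomial.eval_C] at this
  exact this.symm

/-- A set on which only the zero polynomial vanishes. -/
def IsZariskiDense (S : Set (σ → ℂ)) : Prop :=
  ∀ c : MvPolynomial σ ℂ, (∀ y ∈ S, eval y c = 0) → c = 0

theorem natDegree_lineSubst_ne_zero {f : MvPolynomial σ ℂ} {v y : σ → ℂ} {w : ℂ}
    (h : eval (y + w • v) f ≠ eval y f) : (lineSubst v f).natDegree ≠ 0 := by
  intro h0
  rw [Polynomial.natDegree_eq_zero] at h0
  obtain ⟨c, hc⟩ := h0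
  have h1 := eval_map_lineSubst v y w f
  have h2 := eval_map_lineSubst v y 0 f
  rw [← hc] at h1 h2
  simp only [Polynomial.map_C, Polynomial.eval_C, zero_smul, add_zero] at h1 h2
  exact h (h1.symm.trans h2)

theorem dvd_of_common_zeros {f g : MvPolynomial σ ℂ} (hf : Irreducible f) {v : σ → ℂ}
    (hdeg : (lineSubst v f).natDegree ≠ 0) {S : Set (σ → ℂ)} (hS : IsZariskiDense S)
    (h : ∀ y ∈ S, ∃ w : ℂ, eval (y + w • v) f = 0 ∧ eval (y + w • v) g = 0) : f ∣ g := by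
  by_contra hfg
  refine lineResultant_ne_zero hf hfg hdeg (hS _ fun y hy => ?_)
  obtain ⟨w, h1, h2⟩ := h y hy
  exact eval_lineResultant_eq_zero hdeg h1 h2

theorem lineSubst_monomial_bound (v : σ → ℂ) (d : σ →₀ ℕ) :
    (lineSubst v (monomial d 1)).natDegree ≤ d.degree ∧
      (lineSubst v (monomial d 1)).coeff d.degree = C (eval v (monomial d 1)) := by
  induction d using Finsupp.induction_linear with
  | zero => simp [lineSubst]
  | add d e hd he =>
    have h : (monomial (d + e) (1 : ℂ)) = monomial d 1 * monomial e 1 := by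
      simp [monomial_mul]
    rw [h, map_mul, map_add]
    refine ⟨Polynomial.natDegree_mul_le.trans (add_le_add hd.1 he.1), ?_⟩
    rw [Polynomial.coeff_mul_add_eq_of_natDegree_le hd.1 he.1, hd.2, he.2, map_mul, map_mul]
  | single i k =>
    have h : (monomial (Finsupp.single i k) (1 : ℂ)) = X i ^ k := by
      rw [X_pow_eq_monomial]
    have hlin : (lineSubst v (X i)).natDegree ≤ 1 := by
      simp only [lineSubst, aeval_X]
      compute_degree
    have hco : (lineSubst v (X i)).coeff 1 = C (v i) := by
      simp [lineSubst, Polynomial.coeff_C]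
    rw [h, map_pow, Finsupp.degree_single]
    constructor
    · exact (Polynomial.natDegree_pow_le_of_le k hlin).trans (by simp)
    · have := Polynomial.coeff_pow_of_natDegree_le (m := k) hlin
      rw [mul_one] at this
      rw [this, hco]
      simp

theorem lineSubst_monomial (v : σ → ℂ) (d : σ →₀ ℕ) (a : ℂ) :
    lineSubst v (monomial d a) = Polynomial.C (C a) * lineSubst v (monomial d 1) := by
  have : monomial d a = a • monomial d (1 : ℂ) := by simp [smul_monomial]
  rw [this, map_smul, Algebra.smul_def]
  rfl

theorem natDegree_lineSubst_le (v : σ → ℂ) (f : MvPolynomial σ ℂ) :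
    (lineSubst v f).natDegree ≤ f.totalDegree := by
  conv_lhs => rw [f.as_sum, map_sum]
  refine Polynomial.natDegree_sum_le_of_forall_le _ _ fun d hd => ?_
  rw [lineSubst_monomial]
  exact (Polynomial.natDegree_C_mul_le _ _).trans
    ((lineSubst_monomial_bound v d).1.trans (le_totalDegree hd))

/-- The leading coefficient of `w ↦ f(y + w v)`: the top homogeneous part of `f` at `v`. -/
theorem coeff_lineSubst_totalDegree (v : σ → ℂ) (f : MvPolynomial σ ℂ) :
    (lineSubst v f).coeff f.totalDegree =
      C (eval v (homogeneousComponent f.totalDegree f)) := by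
  classical
  conv_lhs => enter [1]; rw [f.as_sum, map_sum]
  rw [Polynomial.finsetSum_coeff, homogeneousComponent_apply, map_sum, map_sum,
    Finset.sum_filter]
  refine Finset.sum_congr rfl fun d hd => ?_
  rw [lineSubst_monomial, Polynomial.coeff_C_mul]
  split_ifs with h
  · rw [← h, (lineSubst_monomial_bound v d).2, ← map_mul]
    simp [eval_monomial]
  · rw [Polynomial.coeff_eq_zero_of_natDegree_lt, mul_zero]
    refine (lineSubst_monomial_bound v d).1.trans_lt (lt_of_le_of_ne (le_totalDegree hd) h)

end LineSubstitution

section Polarization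

open MvPolynomial

/-- Evaluation of a polynomial in two groups of variables. -/
def biEval {σ : Type*} (Q : MvPolynomial (σ ⊕ σ) ℂ) (z ζ : σ → ℂ) : ℂ :=
  eval (Sum.elim z ζ) Q

/-- `Q` is a homogenized complex polarization of the real polynomial `P`. -/
structure IsPolarization {n : ℕ} (P : MvPolynomial (Fin n ⊕ Fin n) ℝ)
    (Q : MvPolynomial (Fin (n + 1) ⊕ Fin (n + 1)) ℂ) (D : ℕ) : Prop where
  star_eval : ∀ z ζ, star (biEval Q z ζ) = biEval Q (star ζ) (star z)
  smul_eval : ∀ (t : ℂ) z ζ, biEval Q (t • z) ζ = t ^ D * biEval Q z ζ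
  diag_eval : ∀ z, z 0 ≠ 0 → biEval Q z (star z) =
    (z 0 * star (z 0)) ^ D * ((realPolyEval P fun i => z i.succ / z 0 : ℝ) : ℂ)

theorem isPolarization_mul_X {n : ℕ} {P : MvPolynomial (Fin n ⊕ Fin n) ℝ}
    {Q : MvPolynomial (Fin (n + 1) ⊕ Fin (n + 1)) ℂ} {D : ℕ} (h : IsPolarization P Q D)
    (i : Fin n ⊕ Fin n) : ∃ Q' D', IsPolarization (P * X i) Q' D' := by
  rcases i with i | i
  · refine ⟨Q * (C (1 / 2) * (X (Sum.inl i.succ) * X (Sum.inr 0) +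
      X (Sum.inl 0) * X (Sum.inr i.succ))), D + 1, ?_, ?_, ?_⟩
    · intro z ζ
      have := h.star_eval z ζ
      simp only [biEval, map_mul, star_mul'] at this ⊢
      rw [this]
      simp
      left
      ring
    · intro t z ζ
      have := h.smul_eval t z ζ
      simp only [biEval, map_mul] at this ⊢
      rw [this]
      simp
      ring
    · intro z hz
      have := h.diag_eval z hz
      simp only [biEval, realPolyEval, map_mul] at this ⊢
      rw [this]
      simp [re_eq_add_conj]
      have : (starRingEnd ℂ) (z 0) ≠ 0 := by simpa using hz
      field_simp
      ring
  · refine ⟨Q * (C (1 / (2 * I)) * (X (Sum.inl i.succ) * X (Sum.inr 0) -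
      X (Sum.inl 0) * X (Sum.inr i.succ))), D + 1, ?_, ?_, ?_⟩
    · intro z ζ
      have := h.star_eval z ζ
      simp only [biEval, map_mul, star_mul'] at this ⊢
      rw [this]
      simp
      ring
    · intro t z ζ
      have := h.smul_eval t z ζ
      simp only [biEval, map_mul] at this ⊢
      rw [this]
      simp
      ring
    · intro z hz
      have := h.diag_eval z hz
      simp only [biEval, realPolyEval, map_mul] at this ⊢
      rw [this]
      simp [im_eq_sub_conj]
      have : (starRingEnd ℂ) (z 0) ≠ 0 := by simpa using hz
      field_simp
      rw [I_sq]
      ring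

theorem exists_isPolarization {n : ℕ} (P : MvPolynomial (Fin n ⊕ Fin n) ℝ) :
    ∃ Q D, IsPolarization P Q D := by
  induction P using MvPolynomial.induction_on with
  | C r =>
    refine ⟨C (r : ℂ), 0, ?_, ?_, ?_⟩ <;> simp [biEval, realPolyEval]
  | add P₁ P₂ h₁ h₂ =>
    obtain ⟨Q₁, D₁, h₁⟩ := h₁
    obtain ⟨Q₂, D₂, h₂⟩ := h₂
    refine ⟨Q₁ * (X (Sum.inl 0) * X (Sum.inr 0)) ^ D₂ +
      Q₂ * (X (Sum.inl 0) * X (Sum.inr 0)) ^ D₁, D₁ + D₂, ?_, ?_, ?_⟩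
    · intro z ζ
      have e₁ := h₁.star_eval z ζ
      have e₂ := h₂.star_eval z ζ
      simp only [biEval, map_mul, map_add, star_mul', star_add] at e₁ e₂ ⊢
      rw [e₁, e₂]
      simp [mul_comm]
    · intro t z ζ
      have e₁ := h₁.smul_eval t z ζ
      have e₂ := h₂.smul_eval t z ζ
      simp only [biEval, map_mul, map_add] at e₁ e₂ ⊢
      rw [e₁, e₂]
      simp
      ring
    · intro z hz
      have e₁ := h₁.diag_eval z hz
      have e₂ := h₂.diag_eval z hz
      simp only [biEval, realPolyEval, map_mul, map_add] at e₁ e₂ ⊢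
      rw [e₁, e₂]
      simp
      ring
  | mul_X P i h =>
    obtain ⟨Q, D, h⟩ := h
    exact isPolarization_mul_X h i

end Polarization

section DirectionalImplicit

open scoped Topology ContDiff

/-- The implicit function theorem in a direction `v` transverse to the zero set of `f`. -/
theorem exists_directional_implicit {𝕜 : Type*} [RCLike 𝕜] {X : Type*} [NormedAddCommGroup X]
    [NormedSpace 𝕜 X] [CompleteSpace X] {f : X → 𝕜} {x₀ v : X} {n : ℕ∞ω} (hn : n ≠ 0)
    (hf : ContDiffAt 𝕜 n f x₀) (h0 : f x₀ = 0) (hv : fderiv 𝕜 f x₀ v ≠ 0) :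
    ∃ θ : X → 𝕜, ContDiffAt 𝕜 n θ x₀ ∧ θ x₀ = 0 ∧ (∀ᶠ x in 𝓝 x₀, f (x + θ x • v) = 0) ∧
      ∀ᶠ x in 𝓝 x₀, f x = 0 → θ x = 0 := by
  let g : X × 𝕜 → 𝕜 := fun q => f (q.1 + q.2 • v)
  have hg : ContDiffAt 𝕜 n g (x₀, 0) := by
    refine ContDiffAt.comp (g := f) (f := fun q : X × 𝕜 => q.1 + q.2 • v) (x₀, 0) ?_ (by fun_prop)
    simpa using hf
  have hd : HasFDerivAt g ((fderiv 𝕜 f x₀).comp (ContinuousLinearMap.fst 𝕜 X 𝕜 +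
      (ContinuousLinearMap.snd 𝕜 X 𝕜).smulRight v)) (x₀, 0) := by
    have h1 : HasFDerivAt f (fderiv 𝕜 f x₀) ((x₀, (0 : 𝕜)).1 + (x₀, (0 : 𝕜)).2 • v) := by
      simpa using (hf.differentiableAt hn).hasFDerivAt
    have h2 : HasFDerivAt (fun q : X × 𝕜 => q.1 + q.2 • v) (ContinuousLinearMap.fst 𝕜 X 𝕜 +
      (ContinuousLinearMap.snd 𝕜 X 𝕜).smulRight v) (x₀, 0) :=
      hasFDerivAt_fst.add (hasFDerivAt_snd.smul_const v)
    exact HasFDerivAt.comp (g := f) (x₀, 0) h1 h2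
  have hinv : (fderiv 𝕜 g (x₀, 0) ∘L .inr 𝕜 X 𝕜).IsInvertible := by
    refine ⟨ContinuousLinearEquiv.unitsEquivAut 𝕜 (Units.mk0 _ hv), ?_⟩
    ext
    simp [hd.fderiv]
  have hg0 : g (x₀, 0) = 0 := by simp [g, h0]
  refine ⟨hg.implicitFunction hn hinv, hg.contDiffAt_implicitFunction hn hinv,
    hg.implicitFunction_apply_self hn hinv, ?_, ?_⟩
  · filter_upwards [hg.eventually_apply_implicitFunction hn hinv] with x hx
    exact hx.trans hg0
  · have h1 := hg.eventually_apply_eq_iff_implicitFunction hn hinv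
    have h2 : Filter.Tendsto (fun x : X => (x, (0 : 𝕜))) (𝓝 x₀) (𝓝 (x₀, 0)) :=
      Continuous.tendsto (by fun_prop) x₀
    filter_upwards [h2.eventually h1] with x hx hfx
    exact hx.1 (by simp [g, hg0, hfx])

end DirectionalImplicit

section Frobenius

open scoped Topology ContDiff

theorem eq_of_hasFDerivAt_zero_ball {X : Type*} [NormedAddCommGroup X] [NormedSpace ℂ X]
    {f : X → ℂ} {c : X} {ε : ℝ} (h : ∀ x ∈ Metric.ball c ε, HasFDerivAt f (0 : X →L[ℂ] ℂ) x)
    {x : X} (hx : x ∈ Metric.ball c ε) : f x = f c := by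
  let : NormedSpace ℝ X := .restrictScalars ℝ ℂ X
  have hc : c ∈ Metric.ball c ε := by
    simpa using (dist_nonneg.trans_lt (Metric.mem_ball.1 hx))
  refine (convex_ball c ε).is_const_of_fderivWithin_eq_zero (𝕜 := ℂ)
    (fun y hy => (h y hy).differentiableAt.differentiableWithinAt) (fun y hy => ?_) hx hc
  rw [fderivWithin_of_isOpen Metric.isOpen_ball hy, (h y hy).fderiv]

theorem mul_eq_mul_of_wronskian_eq_zero {X : Type*} [NormedAddCommGroup X] [NormedSpace ℂ X]
    {f g : X → ℂ} {f' g' : X → X →L[ℂ] ℂ} {c : X} {ε : ℝ}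
    (hf : ∀ x ∈ Metric.ball c ε, HasFDerivAt f (f' x) x)
    (hg : ∀ x ∈ Metric.ball c ε, HasFDerivAt g (g' x) x)
    (hg0 : ∀ x ∈ Metric.ball c ε, g x ≠ 0)
    (hw : ∀ x ∈ Metric.ball c ε, ∀ u, f' x u * g x = f x * g' x u)
    {x : X} (hx : x ∈ Metric.ball c ε) : f x * g c = f c * g x := by
  have hc : c ∈ Metric.ball c ε := by
    simpa using (dist_nonneg.trans_lt (Metric.mem_ball.1 hx))
  have key : f x * (g x)⁻¹ = f c * (g c)⁻¹ := by
    refine eq_of_hasFDerivAt_zero_ball (f := fun x => f x * (g x)⁻¹) (fun y hy => ?_) hx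
    have h1 := (hasDerivAt_inv (hg0 y hy)).comp_hasFDerivAt y (hg y hy)
    have h2 := (hf y hy).mul h1
    refine h2.congr_fderiv ?_
    ext u
    have := hw y hy u
    have h0 := hg0 y hy
    simp
    field_simp
    linear_combination this
  have h1 := hg0 x hx
  have h2 := hg0 c hc
  field_simp at key
  linear_combination key

theorem eventually_eq_zero_of_levi_flat {E : Type*} [NormedAddCommGroup E] [NormedSpace ℂ E]
    [CompleteSpace E] {F : E × E → ℂ} (hF : ContDiff ℂ 2 F) {p p' ν ν' : E}
    (h0 : F (p, p') = 0) (hν : fderiv ℂ F (p, p') (ν, 0) ≠ 0)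
    (hν' : fderiv ℂ F (p, p') (0, ν') ≠ 0)
    (hB : ∀ᶠ x in 𝓝 (p, p'), F x = 0 → ∀ u b,
      fderiv ℂ (fderiv ℂ F) x (fderiv ℂ F x (ν, 0) • u - fderiv ℂ F x (u, 0) • ν, 0)
        (0, fderiv ℂ F x (0, ν') • b - fderiv ℂ F x (0, b) • ν') = 0) :
    ∀ᶠ x in 𝓝 (p, p'), F (x.1, p') = 0 → F (p, x.2) = 0 → F x = 0 := by
  have hF1 : Differentiable ℂ F := hF.differentiable (by norm_num)
  have hF2 : Differentiable ℂ (fderiv ℂ F) :=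
    (hF.fderiv_right (m := 1) (by norm_num)).differentiable (by norm_num)
  obtain ⟨θ, hθ, hθ0, hθF, hFθ⟩ := exists_directional_implicit (v := (ν, (0 : E)))
    (n := 2) (by norm_num) hF.contDiffAt h0 hν
  let G : E × E → E × E := fun q => q + θ q • (ν, (0 : E))
  have hGp : G (p, p') = (p, p') := by simp [G, hθ0]
  have hGc : ContinuousAt G (p, p') := by
    have := hθ.continuousAt
    fun_prop
  have hG : Filter.Tendsto G (𝓝 (p, p')) (𝓝 (p, p')) := by
    have := hGc.tendsto
    rwa [hGp] at this
  have hc1 : ∀ᶠ x in 𝓝 (p, p'), fderiv ℂ F x (ν, 0) ≠ 0 := by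
    have : Continuous fun x => fderiv ℂ F x (ν, 0) := by
      have := hF2.continuous
      fun_prop
    exact this.continuousAt.eventually_ne hν
  have hc2 : ∀ᶠ x in 𝓝 (p, p'), fderiv ℂ F x (0, ν') ≠ 0 := by
    have : Continuous fun x => fderiv ℂ F x (0, ν') := by
      have := hF2.continuous
      fun_prop
    exact this.continuousAt.eventually_ne hν'
  have hall := ((hθ.eventually (by decide)).and (hθF.eventually_nhds.and (hFθ.and
    ((hG.eventually hc1).and ((hG.eventually hc2).and (hG.eventually hB))))))
  obtain ⟨ε, hε, hball⟩ := Metric.eventually_nhds_iff_ball.1 hall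
  have hmem : ∀ {y ζ}, y ∈ Metric.ball p ε → ζ ∈ Metric.ball p' ε →
      (y, ζ) ∈ Metric.ball (p, p') ε := by
    intro y ζ hy hζ
    rw [← ball_prod_same]
    exact ⟨hy, hζ⟩
  have hθd : ∀ q ∈ Metric.ball (p, p') ε, HasFDerivAt θ (fderiv ℂ θ q) q := fun q hq =>
    ((hball q hq).1.differentiableAt (by norm_num)).hasFDerivAt
  -- differentiating `F (G q) = 0`
  have hdiff : ∀ q ∈ Metric.ball (p, p') ε, ∀ h,
      fderiv ℂ F (G q) h + fderiv ℂ θ q h * fderiv ℂ F (G q) (ν, 0) = 0 := by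
    intro q hq h
    have h1 : HasFDerivAt G (ContinuousLinearMap.id ℂ (E × E) +
        (fderiv ℂ θ q).smulRight (ν, (0 : E))) q :=
      (hasFDerivAt_id q).add ((hθd q hq).smul_const _)
    have h2 : HasFDerivAt (fun q => F (G q)) _ q := (hF1 (G q)).hasFDerivAt.comp q h1
    have h3 : HasFDerivAt (fun q => F (G q)) (0 : E × E →L[ℂ] ℂ) q :=
      (hasFDerivAt_const (0 : ℂ) q).congr_of_eventuallyEq (hball q hq).2.1
    have := congrArg (fun T => T h) (h2.unique h3)
    simpa only [ContinuousLinearMap.comp_apply, add_apply, ContinuousLinearMap.id_apply,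
      ContinuousLinearMap.smulRight_apply, map_add, map_smul, smul_eq_mul,
      zero_apply] using this
  -- the slopes of the leaves are constant in `y`
  have hκ : ∀ y ∈ Metric.ball p ε, ∀ ζ ∈ Metric.ball p' ε, ∀ b,
      fderiv ℂ F (G (y, ζ)) (0, b) * fderiv ℂ F (G (p, ζ)) (0, ν') =
        fderiv ℂ F (G (p, ζ)) (0, b) * fderiv ℂ F (G (y, ζ)) (0, ν') := by
    intro y hy ζ hζ b
    have hder : ∀ c : E, ∀ x ∈ Metric.ball p ε,
        HasFDerivAt (fun x => fderiv ℂ F (G (x, ζ)) (0, c))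
          (((fderiv ℂ (fderiv ℂ F) (G (x, ζ))).comp (ContinuousLinearMap.inl ℂ E E +
            ((fderiv ℂ θ (x, ζ)).comp (ContinuousLinearMap.inl ℂ E E)).smulRight
              (ν, (0 : E)))).flip (0, c)) x := by
      intro c x hx
      have h0 : HasFDerivAt (fun x : E => (x, ζ)) (ContinuousLinearMap.inl ℂ E E) x :=
        hasFDerivAt_prodMk_left x ζ
      have h1 : HasFDerivAt (fun x => G (x, ζ)) (ContinuousLinearMap.inl ℂ E E +
          ((fderiv ℂ θ (x, ζ)).comp (ContinuousLinearMap.inl ℂ E E)).smulRight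
            (ν, (0 : E))) x :=
        h0.add ((HasFDerivAt.comp (g := θ) (f := fun x => (x, ζ)) x (hθd _ (hmem hx hζ))
          h0).smul_const _)
      have h2 := HasFDerivAt.comp x (hF2 (G (x, ζ))).hasFDerivAt h1
      have h3 := h2.clm_apply (hasFDerivAt_const ((0 : E), c) x)
      refine h3.congr_fderiv ?_
      ext u
      simp
    refine mul_eq_mul_of_wronskian_eq_zero (hder b) (hder ν')
      (fun x hx => (hball _ (hmem hx hζ)).2.2.2.2.1) (fun x hx u => ?_) hy
    have hxb := hball _ (hmem hx hζ)
    have hlev := hxb.2.2.2.2.2 hxb.2.1.self_of_nhds u b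
    have hD := hxb.2.2.2.1
    have hd := hdiff _ (hmem hx hζ) (u, 0)
    set x' := G (x, ζ) with hx'
    have e1 : ((fderiv ℂ F x' (ν, 0) • u - fderiv ℂ F x' (u, 0) • ν, 0) : E × E) =
        fderiv ℂ F x' (ν, 0) • ((u, 0) + fderiv ℂ θ (x, ζ) (u, 0) • (ν, 0)) := by
      have : fderiv ℂ F x' (u, 0) = - (fderiv ℂ θ (x, ζ) (u, 0) * fderiv ℂ F x' (ν, 0)) := by
        linear_combination hd
      rw [this]
      ext
      · simp [smul_smul, mul_comm]
      · simp
    have e2 : ((0, fderiv ℂ F x' (0, ν') • b - fderiv ℂ F x' (0, b) • ν') : E × E) =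
        fderiv ℂ F x' (0, ν') • (0, b) - fderiv ℂ F x' (0, b) • (0, ν') := by
      ext <;> simp
    rw [e1, e2, map_smul, smul_apply, smul_eq_zero] at hlev
    have hlev := hlev.resolve_left hD
    rw [map_sub, map_smul, map_smul, smul_eq_mul, smul_eq_mul] at hlev
    simp only [ContinuousLinearMap.flip_apply, ContinuousLinearMap.comp_apply,
      add_apply, ContinuousLinearMap.inl_apply,
      ContinuousLinearMap.smulRight_apply]
    linear_combination hlev
  -- parametrize the second factor
  have hFp : ContDiff ℂ 2 fun ξ => F (p, ξ) := hF.comp (by fun_prop)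
  have hFpd : ∀ ξ, HasFDerivAt (fun ξ => F (p, ξ))
      ((fderiv ℂ F (p, ξ)).comp (ContinuousLinearMap.inr ℂ E E)) ξ := fun ξ =>
    HasFDerivAt.comp ξ (hF1 (p, ξ)).hasFDerivAt (hasFDerivAt_prodMk_right p ξ)
  obtain ⟨τ, hτ, hτ0, hτF, hFτ⟩ := exists_directional_implicit (f := fun ξ => F (p, ξ))
    (v := ν') (x₀ := p') (n := 2) (by norm_num) hFp.contDiffAt h0
    (by rw [(hFpd p').fderiv]; simpa using hν')
  let Z : E → E := fun ξ => ξ + τ ξ • ν'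
  have hZp : Z p' = p' := by simp [Z, hτ0]
  have hZ : Filter.Tendsto Z (𝓝 p') (𝓝 p') := by
    have h : ContinuousAt Z p' := by
      have := hτ.continuousAt
      fun_prop
    have := h.tendsto
    rwa [hZp] at this
  obtain ⟨δ, hδ, hδball⟩ := Metric.eventually_nhds_iff_ball.1 ((hτ.eventually (by decide)).and
    (hτF.eventually_nhds.and (hFτ.and (hZ.eventually (Metric.ball_mem_nhds p' hε)))))
  have hconst : ∀ y ∈ Metric.ball p ε, ∀ ξ ∈ Metric.ball p' δ, θ (y, Z ξ) = θ (y, p') := by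
    intro y hy ξ hξ
    have := eq_of_hasFDerivAt_zero_ball (f := fun ξ => θ (y, Z ξ)) (c := p') (ε := δ) ?_ hξ
    · rw [this, hZp]
    intro x hx
    obtain ⟨hx1, hx2, -, hx4⟩ := hδball x hx
    have hZd : HasFDerivAt Z (ContinuousLinearMap.id ℂ E + (fderiv ℂ τ x).smulRight ν') x :=
      (hasFDerivAt_id x).add ((hx1.differentiableAt (by norm_num)).hasFDerivAt.smul_const _)
    have h1 := HasFDerivAt.comp (g := θ) (f := fun x => (y, Z x)) x (hθd _ (hmem hy hx4))
      (HasFDerivAt.comp (g := Prod.mk y) x (hasFDerivAt_prodMk_right y (Z x)) hZd)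
    refine h1.congr_fderiv ?_
    ext c
    have h2 := HasFDerivAt.comp (g := fun ξ => F (p, ξ)) x (hFpd (Z x)) hZd
    have h3 : HasFDerivAt (fun x => F (p, Z x)) (0 : E →L[ℂ] ℂ) x :=
      (hasFDerivAt_const (0 : ℂ) x).congr_of_eventuallyEq hx2
    have h4 := congrArg (fun T : E →L[ℂ] ℂ => T c) (h2.unique h3)
    simp only [ContinuousLinearMap.comp_apply, ContinuousLinearMap.inr_apply,
      zero_apply] at h4 ⊢
    set b := (ContinuousLinearMap.id ℂ E + (fderiv ℂ τ x).smulRight ν') c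
    have hpb : p ∈ Metric.ball p ε := Metric.mem_ball_self hε
    have hθp : θ (p, Z x) = 0 :=
      (hball _ (hmem hpb hx4)).2.2.1 hx2.self_of_nhds
    have hGp' : G (p, Z x) = (p, Z x) := by simp [G, hθp]
    have h5 := hκ y hy (Z x) hx4 b
    have hne := (hball _ (hmem hpb hx4)).2.2.2.2.1
    rw [hGp'] at h5 hne
    rw [h4, zero_mul] at h5
    have h6 := (mul_eq_zero.1 h5).resolve_right hne
    have h7 := hdiff _ (hmem hy hx4) (0, b)
    rw [h6, zero_add] at h7
    exact (mul_eq_zero.1 h7).resolve_right (hball _ (hmem hy hx4)).2.2.2.1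
  have hfin : ∀ᶠ x : E × E in 𝓝 (p, p'), x.1 ∈ Metric.ball p ε ∧ x.2 ∈ Metric.ball p' ε ∧
      x.2 ∈ Metric.ball p' δ := by
    rw [nhds_prod_eq]
    refine Filter.Eventually.prod_mk (Metric.ball_mem_nhds p hε)
      (Filter.inter_mem (Metric.ball_mem_nhds p' hε) (Metric.ball_mem_nhds p' hδ))
  filter_upwards [hfin] with x hx hx1 hx2
  obtain ⟨hx3, hx4, hx5⟩ := hx
  have e1 : θ (x.1, p') = 0 :=
    (hball _ (hmem hx3 (Metric.mem_ball_self hε))).2.2.1 hx1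
  have e2 : Z x.2 = x.2 := by simp [Z, (hδball _ hx5).2.2.1 hx2]
  have e3 := hconst _ hx3 _ hx5
  rw [e1, e2] at e3
  have e4 := (hball _ (hmem hx3 hx4)).2.1.self_of_nhds
  simpa [e3] using e4

end Frobenius

section LeviTransfer

open scoped Topology ContDiff

theorem derivatives_of_vanishing_on_graph {X : Type*} [NormedAddCommGroup X] [NormedSpace ℝ X]
    {ψ θ : X → ℝ} {q ν : X} (hψ : ContDiffAt ℝ 2 ψ q) (hθ : ContDiffAt ℝ 2 θ q)
    (hθ0 : θ q = 0) (h : ∀ᶠ x in 𝓝 q, ψ (x + θ x • ν) = 0) :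
    (∀ w, fderiv ℝ ψ q w + fderiv ℝ θ q w * fderiv ℝ ψ q ν = 0) ∧
      ∀ w, fderiv ℝ θ q w = 0 → fderiv ℝ (fderiv ℝ ψ) q w w +
        fderiv ℝ (fderiv ℝ θ) q w w * fderiv ℝ ψ q ν = 0 := by
  let G : X → X := fun x => x + θ x • ν
  have hGq : G q = q := by simp [G, hθ0]
  have hG : Filter.Tendsto G (𝓝 q) (𝓝 q) := by
    have h : ContinuousAt G q := by
      have := hθ.continuousAt
      fun_prop
    have := h.tendsto
    rwa [hGq] at this
  have hGd : ∀ {x}, DifferentiableAt ℝ θ x →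
      HasFDerivAt G (ContinuousLinearMap.id ℝ X + (fderiv ℝ θ x).smulRight ν) x := fun hx =>
    (hasFDerivAt_id _).add (hx.hasFDerivAt.smul_const _)
  have h1 : ∀ᶠ x in 𝓝 q, ∀ w,
      fderiv ℝ ψ (G x) w + fderiv ℝ θ x w * fderiv ℝ ψ (G x) ν = 0 := by
    filter_upwards [h.eventually_nhds, hθ.eventually (by decide),
      hG.eventually (hψ.eventually (by decide))] with x hx hx1 hx2 w
    have e1 : HasFDerivAt (fun x => ψ (G x)) _ x :=
      HasFDerivAt.comp x (hx2.differentiableAt (by norm_num)).hasFDerivAt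
        (hGd (hx1.differentiableAt (by norm_num)))
    have e2 : HasFDerivAt (fun x => ψ (G x)) (0 : X →L[ℝ] ℝ) x :=
      (hasFDerivAt_const (0 : ℝ) x).congr_of_eventuallyEq hx
    have := congrArg (fun T : X →L[ℝ] ℝ => T w) (e1.unique e2)
    simpa only [ContinuousLinearMap.comp_apply, add_apply, ContinuousLinearMap.id_apply,
      ContinuousLinearMap.smulRight_apply, map_add, map_smul, smul_eq_mul,
      zero_apply] using this
  have hθ1 : DifferentiableAt ℝ θ q := hθ.differentiableAt (by norm_num)
  refine ⟨fun w => by simpa [hGq] using h1.self_of_nhds w, fun w hw => ?_⟩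
  have hψ2 : DifferentiableAt ℝ (fderiv ℝ ψ) (G q) := by
    rw [hGq]
    exact (hψ.fderiv_right (m := 1) (by norm_num)).differentiableAt (by norm_num)
  have hθ2 : DifferentiableAt ℝ (fderiv ℝ θ) q :=
    (hθ.fderiv_right (m := 1) (by norm_num)).differentiableAt (by norm_num)
  have hc : HasFDerivAt (fun x => fderiv ℝ ψ (G x)) _ q :=
    HasFDerivAt.comp q hψ2.hasFDerivAt (hGd hθ1)
  have e1 := (hc.clm_apply (hasFDerivAt_const w q)).add
    ((hθ2.hasFDerivAt.clm_apply (hasFDerivAt_const w q)).mul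
      (hc.clm_apply (hasFDerivAt_const ν q)))
  have e2 : HasFDerivAt (fun x => fderiv ℝ ψ (G x) w + fderiv ℝ θ x w * fderiv ℝ ψ (G x) ν)
      (0 : X →L[ℝ] ℝ) q :=
    (hasFDerivAt_const (0 : ℝ) q).congr_of_eventuallyEq (h1.mono fun x hx => hx w)
  have := congrArg (fun T : X →L[ℝ] ℝ => T w) (e1.unique e2)
  simp [hw, hGq] at this
  linear_combination this

theorem exists_smul_fderiv_of_zero_subset {X : Type*} [NormedAddCommGroup X] [NormedSpace ℝ X]
    [CompleteSpace X] {φ ρ : X → ℝ} {q : X} (hφ : ContDiffAt ℝ 2 φ q) (hρ : ContDiffAt ℝ 2 ρ q)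
    (hφ0 : φ q = 0) (hd : fderiv ℝ φ q ≠ 0) (h : ∀ᶠ x in 𝓝 q, φ x = 0 → ρ x = 0) :
    ∃ l : ℝ, fderiv ℝ ρ q = l • fderiv ℝ φ q ∧ ∀ w, fderiv ℝ φ q w = 0 →
      fderiv ℝ (fderiv ℝ ρ) q w w = l * fderiv ℝ (fderiv ℝ φ) q w w := by
  obtain ⟨ν, hν⟩ : ∃ ν, fderiv ℝ φ q ν ≠ 0 := by
    by_contra hcon
    push Not at hcon
    exact hd (by ext w; simp [hcon])
  obtain ⟨θ, hθ, hθ0, h1, -⟩ := exists_directional_implicit (n := 2) (by norm_num) hφ hφ0 hν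
  have hG : Filter.Tendsto (fun x => x + θ x • ν) (𝓝 q) (𝓝 q) := by
    have h : ContinuousAt (fun x => x + θ x • ν) q := by
      have := hθ.continuousAt
      fun_prop
    simpa [hθ0] using h.tendsto
  have h2 : ∀ᶠ x in 𝓝 q, ρ (x + θ x • ν) = 0 := by
    filter_upwards [hG.eventually h, h1] with x hx hx1 using hx hx1
  obtain ⟨a1, a2⟩ := derivatives_of_vanishing_on_graph hφ hθ hθ0 h1
  obtain ⟨b1, b2⟩ := derivatives_of_vanishing_on_graph hρ hθ hθ0 h2
  refine ⟨fderiv ℝ ρ q ν / fderiv ℝ φ q ν, ?_, fun w hw => ?_⟩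
  · ext w
    have := a1 w
    have := b1 w
    simp
    field_simp
    linear_combination (fderiv ℝ φ q ν) * b1 w - (fderiv ℝ ρ q ν) * a1 w
  · have hw' : fderiv ℝ θ q w = 0 := by
      have := a1 w
      rw [hw, zero_add] at this
      exact (mul_eq_zero.1 this).resolve_right hν
    have c1 := a2 w hw'
    have c2 := b2 w hw'
    field_simp
    linear_combination (fderiv ℝ φ q ν) * c2 - (fderiv ℝ ρ q ν) * c1

/-- The totally real embedding `z ↦ (z, z̄)`. -/
def conjGraph (m : ℕ) : (Fin m → ℂ) →L[ℝ] (Fin m → ℂ) × (Fin m → ℂ) :=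
  (ContinuousLinearMap.id ℝ _).prod (starL' ℝ : (Fin m → ℂ) ≃L[ℝ] (Fin m → ℂ))

@[simp] theorem conjGraph_apply {m : ℕ} (z : Fin m → ℂ) : conjGraph m z = (z, star z) := rfl

/-- The real part of `F` along the diagonal `ζ = z̄`. -/
def diagRe {m : ℕ} (F : (Fin m → ℂ) × (Fin m → ℂ) → ℂ) (z : Fin m → ℂ) : ℝ :=
  (F (z, star z)).re

variable {m : ℕ} {F : (Fin m → ℂ) × (Fin m → ℂ) → ℂ}

theorem hasFDerivAt_comp_conjGraph {G : Type*} [NormedAddCommGroup G] [NormedSpace ℂ G]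
    {F : (Fin m → ℂ) × (Fin m → ℂ) → G} (hF : Differentiable ℂ F) (z : Fin m → ℂ) :
    HasFDerivAt (fun z => F (z, star z))
      (((fderiv ℂ F (z, star z)).restrictScalars ℝ).comp (conjGraph m)) z :=
  ((hF (z, star z)).hasFDerivAt.restrictScalars ℝ).comp z (conjGraph m).hasFDerivAt

theorem fderiv_diagRe (hF : Differentiable ℂ F) (z w : Fin m → ℂ) :
    fderiv ℝ (diagRe F) z w = (fderiv ℂ F (z, star z) (w, star w)).re := by
  have := reCLM.hasFDerivAt.comp z (hasFDerivAt_comp_conjGraph hF z)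
  have h : fderiv ℝ (diagRe F) z = _ := HasFDerivAt.fderiv this
  rw [h]
  simp

theorem fderiv_fderiv_diagRe (hF : ContDiff ℂ 2 F) (z w : Fin m → ℂ) :
    fderiv ℝ (fderiv ℝ (diagRe F)) z w w =
      (fderiv ℂ (fderiv ℂ F) (z, star z) (w, star w) (w, star w)).re := by
  have hF1 : Differentiable ℂ F := hF.differentiable (by norm_num)
  have hF2 : Differentiable ℂ (fderiv ℂ F) :=
    (hF.fderiv_right (m := 1) (by norm_num)).differentiable (by norm_num)
  have hR : ContDiff ℝ 2 (diagRe F) :=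
    reCLM.contDiff.comp ((hF.restrict_scalars ℝ).comp (conjGraph m).contDiff)
  have h1 : HasFDerivAt (fun z => fderiv ℝ (diagRe F) z w)
      ((fderiv ℝ (fderiv ℝ (diagRe F)) z).flip w) z := by
    have := (((hR.fderiv_right (m := 1) (by norm_num)).differentiable (by norm_num)) z).hasFDerivAt
    refine (this.clm_apply (hasFDerivAt_const w z)).congr_fderiv ?_
    ext
    simp
  have hd : ∀ x, HasFDerivAt (fun x => fderiv ℂ F x (w, star w))
      ((fderiv ℂ (fderiv ℂ F) x).flip (w, star w)) x := fun x => by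
    refine ((hF2 x).hasFDerivAt.clm_apply (hasFDerivAt_const (w, star w) x)).congr_fderiv ?_
    ext <;> simp
  have h2 := hasFDerivAt_comp_conjGraph (fun x => (hd x).differentiableAt) z
  rw [(hd _).fderiv] at h2
  have h3 := reCLM.hasFDerivAt.comp z h2
  have h4 : (fun z => fderiv ℝ (diagRe F) z w) =
      reCLM ∘ fun z => (fderiv ℂ F (z, star z)) (w, star w) := by
    ext z
    rw [fderiv_diagRe hF1]
    rfl
  rw [h4] at h1
  have := congrArg (fun T : (Fin m → ℂ) →L[ℝ] ℝ => T w) (h1.unique h3)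
  simpa using this

theorem fderiv_snd_eq_star (hF : Differentiable ℂ F) (him : ∀ z, (F (z, star z)).im = 0)
    (z w : Fin m → ℂ) :
    fderiv ℂ F (z, star z) (0, star w) = star (fderiv ℂ F (z, star z) (w, 0)) := by
  have hreal : ∀ w, (fderiv ℂ F (z, star z) (w, star w)).im = 0 := by
    intro w
    have h1 := imCLM.hasFDerivAt.comp z (hasFDerivAt_comp_conjGraph hF z)
    have h2 : (imCLM ∘ fun z => F (z, star z)) = fun _ => (0 : ℝ) := funext him
    rw [h2] at h1
    have := congrArg (fun T : (Fin m → ℂ) →L[ℝ] ℝ => T w)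
      (h1.unique (hasFDerivAt_const (0 : ℝ) z))
    simpa using this
  have hsplit : ∀ a b : Fin m → ℂ, fderiv ℂ F (z, star z) (a, b) =
      fderiv ℂ F (z, star z) (a, 0) + fderiv ℂ F (z, star z) (0, b) := fun a b => by
    rw [← map_add]
    simp
  have h1 := hreal w
  have h2 := hreal (I • w)
  have e1 : ((I • w, (0 : Fin m → ℂ))) = I • (w, (0 : Fin m → ℂ)) := by simp
  have e2 : (((0 : Fin m → ℂ), star (I • w))) = (-I) • ((0 : Fin m → ℂ), star w) := by
    ext <;> simp
  rw [hsplit] at h1 h2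
  rw [e1, e2, map_smul, map_smul] at h2
  apply Complex.ext
  · simp at h2 ⊢
    linarith
  · simp at h1 ⊢
    linarith

theorem levi_diagRe (hF : ContDiff ℂ 2 F) (q w : Fin m → ℂ) :
    fderiv ℝ (fderiv ℝ (diagRe F)) q w w +
        fderiv ℝ (fderiv ℝ (diagRe F)) q (I • w) (I • w) =
      4 * (fderiv ℂ (fderiv ℂ F) (q, star q) (w, 0) (0, star w)).re := by
  have hsplit : ∀ a b : Fin m → ℂ, (a, b) = (a, (0 : Fin m → ℂ)) + ((0 : Fin m → ℂ), b) :=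
    fun a b => by simp
  have hsymm : IsSymmSndFDerivAt ℂ F (q, star q) :=
    hF.contDiffAt.isSymmSndFDerivAt (by simp)
  rw [fderiv_fderiv_diagRe hF, fderiv_fderiv_diagRe hF]
  have e1 : ((I • w, star (I • w))) = I • (w, (0 : Fin m → ℂ)) - I • ((0 : Fin m → ℂ), star w) := by
    ext <;> simp
  rw [e1, hsplit w (star w)]
  simp only [map_add, map_sub, map_smul, add_apply, sub_apply, smul_apply, smul_eq_mul]
  rw [hsymm (0, star w) (w, 0)]
  simp
  ring

theorem levi_eq_zero_of_hypersurface (hF : ContDiff ℂ 2 F) (him : ∀ z, (F (z, star z)).im = 0)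
    {q : Fin m → ℂ} (hq : F (q, star q) = 0) (hd : ∃ ν, fderiv ℂ F (q, star q) (ν, 0) ≠ 0)
    {ρ : (Fin m → ℂ) → ℝ} (hρ : ContDiffAt ℝ 2 ρ q) (hρd : fderiv ℝ ρ q ≠ 0)
    (hsub : ∀ᶠ z in 𝓝 q, F (z, star z) = 0 → ρ z = 0)
    (hlevi : ∀ w, IsComplexTangent ρ q w → leviForm ρ q w = 0)
    {w : Fin m → ℂ} (hw : fderiv ℂ F (q, star q) (w, 0) = 0) :
    fderiv ℂ (fderiv ℂ F) (q, star q) (w, 0) (0, star w) = 0 := by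
  have hF1 : Differentiable ℂ F := hF.differentiable (by norm_num)
  have hF2 : Differentiable ℂ (fderiv ℂ F) :=
    (hF.fderiv_right (m := 1) (by norm_num)).differentiable (by norm_num)
  have hR : ContDiff ℝ 2 (diagRe F) :=
    reCLM.contDiff.comp ((hF.restrict_scalars ℝ).comp (conjGraph m).contDiff)
  have hsplit : ∀ a b : Fin m → ℂ, (a, b) = (a, (0 : Fin m → ℂ)) + ((0 : Fin m → ℂ), b) :=
    fun a b => by simp
  have hdR : ∀ u, fderiv ℝ (diagRe F) q u = 2 * (fderiv ℂ F (q, star q) (u, 0)).re := by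
    intro u
    rw [fderiv_diagRe hF1, hsplit u, map_add, fderiv_snd_eq_star hF1 him]
    simp
    ring
  have hd' : fderiv ℝ (diagRe F) q ≠ 0 := by
    intro h0
    obtain ⟨ν, hν⟩ := hd
    have h1 := hdR ν
    have h2 := hdR (I • ν)
    have e1 : ((I • ν, (0 : Fin m → ℂ))) = I • (ν, (0 : Fin m → ℂ)) := by simp
    rw [e1, (fderiv ℂ F _).map_smul] at h2
    simp only [h0, zero_apply] at h1 h2
    exact hν (Complex.ext (by simpa using h1) (by simpa using h2))
  obtain ⟨l, hl1, hl2⟩ := exists_smul_fderiv_of_zero_subset hR.contDiffAt hρ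
    (by simp [diagRe, hq]) hd' (by
      filter_upwards [hsub] with z hz h0
      exact hz (Complex.ext h0 (him z)))
  have hl0 : l ≠ 0 := by
    rintro rfl
    exact hρd (by simpa using hl1)
  have hIw : fderiv ℂ F (q, star q) (I • w, 0) = 0 := by
    have e1 : ((I • w, (0 : Fin m → ℂ))) = I • (w, (0 : Fin m → ℂ)) := by simp
    rw [e1, map_smul, hw, smul_zero]
  have t1 : fderiv ℝ (diagRe F) q w = 0 := by simp [hdR, hw]
  have t2 : fderiv ℝ (diagRe F) q (I • w) = 0 := by simp [hdR, hIw]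
  -- the Levi form vanishes on the complex span of `w`; its real and imaginary parts
  have key := hlevi w ⟨by simp [hl1, t1], by simp [hl1, t2]⟩
  simp only [leviForm, iteratedFDeriv_two_apply, Matrix.cons_val_zero, Matrix.cons_val_one,
    hl2 _ t1, hl2 _ t2] at key
  rw [← mul_add, levi_diagRe hF] at key
  have key := (mul_eq_zero.1 key).resolve_left hl0
  have key' := levi_diagRe (F := fun x => (-I) • F x) (hF.const_smul (-I)) q w
  have e3 : diagRe (fun x => (-I) • F x) = fun _ => 0 := by
    ext z
    simp [diagRe, him]
  have e4 : fderiv ℂ (fun x => (-I) • F x) = fun x => (-I) • fderiv ℂ F x :=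
    funext fun x => fderiv_fun_const_smul (hF1 x) _
  have e5 : fderiv ℂ (fun x => (-I) • fderiv ℂ F x) (q, star q) =
      (-I) • fderiv ℂ (fderiv ℂ F) (q, star q) := fderiv_fun_const_smul (hF2 _) _
  rw [e3, e4, e5] at key'
  apply Complex.ext
  · simp at key ⊢
    exact key
  · simp at key' ⊢
    exact key'

end LeviTransfer

section PolynomialCalculus

open MvPolynomial
open scoped Topology ContDiff

variable {τ : Type*}

theorem contDiff_eval [Fintype τ] {n : ℕ∞ω} (f : MvPolynomial τ ℂ) :
    ContDiff ℂ n fun x => eval x f := by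
  induction f using MvPolynomial.induction_on with
  | C a => simpa using contDiff_const
  | add f g hf hg => simpa using hf.add hg
  | mul_X f i hf => simpa using hf.mul (contDiff_apply ℂ ℂ i)

theorem differentiable_eval [Fintype τ] (f : MvPolynomial τ ℂ) :
    Differentiable ℂ fun x => eval x f :=
  (contDiff_eval (n := 1) f).differentiable (by norm_num)

theorem continuous_eval_mv [Fintype τ] (f : MvPolynomial τ ℂ) : Continuous fun x => eval x f :=
  (differentiable_eval f).continuous

/-- The formal derivative of a polynomial in a constant direction. -/
def dirDeriv (w : τ → ℂ) : Derivation ℂ (MvPolynomial τ ℂ) (MvPolynomial τ ℂ) :=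
  mkDerivation ℂ fun i => C (w i)

theorem fderiv_eval [Fintype τ] (f : MvPolynomial τ ℂ) (x w : τ → ℂ) :
    fderiv ℂ (fun x => eval x f) x w = eval x (dirDeriv w f) := by
  induction f using MvPolynomial.induction_on with
  | C a => simp [dirDeriv]
  | add f g hf hg =>
    simp only [map_add, ← hf, ← hg]
    rw [fderiv_fun_add (differentiable_eval f x) (differentiable_eval g x)]
    rfl
  | mul_X f i hf =>
    simp only [map_mul, eval_X, Derivation.leibniz, map_add, smul_eq_mul, ← hf]
    have h : HasFDerivAt (fun x : τ → ℂ => x i) (ContinuousLinearMap.proj (R := ℂ) i) x :=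
      hasFDerivAt_apply i x
    have h1 := ((differentiable_eval f x).hasFDerivAt.fun_mul h).fderiv
    rw [h1]
    simp [dirDeriv]

theorem exists_irreducible_factor {f : MvPolynomial τ ℂ} (hf : f ≠ 0) {x : τ → ℂ}
    (hx : eval x f = 0) : ∃ g, Irreducible g ∧ g ∣ f ∧ eval x g = 0 := by
  induction f using WfDvdMonoid.induction_on_irreducible with
  | zero => exact absurd rfl hf
  | unit u hu => exact absurd hx (hu.map (eval x)).ne_zero
  | mul a i ha hi ih =>
    rw [map_mul, mul_eq_zero] at hx
    rcases hx with h | h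
    · exact ⟨i, hi, dvd_mul_right _ _, h⟩
    · obtain ⟨g, h1, h2, h3⟩ := ih ha h
      exact ⟨g, h1, h2.mul_left _, h3⟩

/-- The irreducible factor of `Q` through a smooth zero of `Q`. -/
theorem exists_irreducible_factor_of_deriv_ne_zero {Q : MvPolynomial τ ℂ} {x v : τ → ℂ}
    (hx : eval x Q = 0) (hv : eval x (dirDeriv v Q) ≠ 0) :
    ∃ f h, Irreducible f ∧ Q = f * h ∧ eval x f = 0 ∧ eval x h ≠ 0 ∧
      eval x (dirDeriv v f) ≠ 0 := by
  have hQ : Q ≠ 0 := by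
    rintro rfl
    simp at hv
  obtain ⟨f, hf, ⟨h, rfl⟩, hfx⟩ := exists_irreducible_factor hQ hx
  rw [Derivation.leibniz, map_add, smul_eq_mul, smul_eq_mul, map_mul, map_mul, hfx, zero_mul,
    zero_add] at hv
  exact ⟨f, h, hf, rfl, hfx, left_ne_zero_of_mul hv, right_ne_zero_of_mul hv⟩

theorem exists_eval_ne_of_deriv [Fintype τ] {f : MvPolynomial τ ℂ} {x v : τ → ℂ}
    (h : eval x (dirDeriv v f) ≠ 0) : ∃ w : ℂ, eval (x + w • v) f ≠ eval x f := by
  by_contra! hc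
  have h1 : HasDerivAt (fun w : ℂ => x + w • v) ((1 : ℂ) • v) 0 :=
    ((hasDerivAt_id (0 : ℂ)).smul_const v).const_add x
  have h2 : HasFDerivAt (fun x => eval x f) (fderiv ℂ (fun x => eval x f) x)
      (x + (0 : ℂ) • v) := by
    simpa using (differentiable_eval f x).hasFDerivAt
  have h3 := h2.comp_hasDerivAt (0 : ℂ) h1
  have h4 : ((fun x => eval x f) ∘ fun w : ℂ => x + w • v) = fun _ => eval x f := funext hc
  rw [h4] at h3
  have h5 := h3.unique (hasDerivAt_const (0 : ℂ) (eval x f))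
  rw [one_smul, fderiv_eval] at h5
  exact h h5

theorem natDegree_lineSubst_ne_zero_of_deriv [Fintype τ] {f : MvPolynomial τ ℂ} {x v : τ → ℂ}
    (h : eval x (dirDeriv v f) ≠ 0) : (lineSubst v f).natDegree ≠ 0 := by
  obtain ⟨w, hw⟩ := exists_eval_ne_of_deriv h
  exact natDegree_lineSubst_ne_zero hw

theorem isZariskiDense_of_mem_nhds [Finite τ] {S : Set (τ → ℂ)} {x : τ → ℂ} (hS : S ∈ 𝓝 x) :
    IsZariskiDense S := by
  have := Fintype.ofFinite τ
  obtain ⟨ε, hε, hb⟩ := Metric.mem_nhds_iff.1 hS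
  intro c hc
  refine funext_set (fun i => Metric.ball (x i) ε) (fun i => ?_) fun y hy => ?_
  · exact infinite_of_mem_nhds (x i) (Metric.ball_mem_nhds _ hε)
  · rw [map_zero]
    refine hc y (hb ?_)
    rw [ball_pi _ hε]
    exact hy

end PolynomialCalculus

section Diagonal

open MvPolynomial
open scoped Topology ContDiff

variable {m : ℕ}

/-- `Q` as a function of a pair of vectors. -/
def biFun (Q : MvPolynomial (Fin m ⊕ Fin m) ℂ) (x : (Fin m → ℂ) × (Fin m → ℂ)) : ℂ :=
  biEval Q x.1 x.2

/-- Concatenation of vectors as a continuous linear map. -/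
def sumElimL (m : ℕ) : (Fin m → ℂ) × (Fin m → ℂ) →L[ℂ] (Fin m ⊕ Fin m → ℂ) :=
  ContinuousLinearMap.pi (Sum.elim
    (fun i => (ContinuousLinearMap.proj i).comp (ContinuousLinearMap.fst ℂ _ _))
    (fun i => (ContinuousLinearMap.proj i).comp (ContinuousLinearMap.snd ℂ _ _)))

theorem sumElimL_apply (x : (Fin m → ℂ) × (Fin m → ℂ)) : sumElimL m x = Sum.elim x.1 x.2 := by
  ext i
  rcases i with i | i <;> simp [sumElimL]

theorem biFun_eq (Q : MvPolynomial (Fin m ⊕ Fin m) ℂ) :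
    biFun Q = (fun x => eval x Q) ∘ sumElimL m := by
  ext x
  simp [biFun, biEval, sumElimL_apply]

theorem contDiff_biFun {n : ℕ∞ω} (Q : MvPolynomial (Fin m ⊕ Fin m) ℂ) :
    ContDiff ℂ n (biFun Q) := by
  rw [biFun_eq]
  exact (contDiff_eval Q).comp (sumElimL m).contDiff

theorem fderiv_biFun (Q : MvPolynomial (Fin m ⊕ Fin m) ℂ) (x h : (Fin m → ℂ) × (Fin m → ℂ)) :
    fderiv ℂ (biFun Q) x h = biFun (dirDeriv (Sum.elim h.1 h.2) Q) x := by
  have h1 := (differentiable_eval Q (sumElimL m x)).hasFDerivAt.comp x (sumElimL m).hasFDerivAt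
  rw [biFun_eq, h1.fderiv, ContinuousLinearMap.comp_apply, fderiv_eval, biFun_eq]
  simp [sumElimL_apply]

theorem fderiv_fderiv_biFun (Q : MvPolynomial (Fin m ⊕ Fin m) ℂ)
    (x h k : (Fin m → ℂ) × (Fin m → ℂ)) :
    fderiv ℂ (fderiv ℂ (biFun Q)) x h k =
      biFun (dirDeriv (Sum.elim h.1 h.2) (dirDeriv (Sum.elim k.1 k.2) Q)) x := by
  have h1 : HasFDerivAt (fun x => fderiv ℂ (biFun Q) x k)
      ((fderiv ℂ (fderiv ℂ (biFun Q)) x).flip k) x := by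
    have := ((((contDiff_biFun (n := 2) Q).fderiv_right (m := 1) (by norm_num)).differentiable
      (by norm_num)) x).hasFDerivAt
    refine (this.clm_apply (hasFDerivAt_const k x)).congr_fderiv ?_
    ext <;> simp
  have h2 : (fun x => fderiv ℂ (biFun Q) x k) = biFun (dirDeriv (Sum.elim k.1 k.2) Q) :=
    funext fun x => fderiv_biFun Q x k
  rw [h2] at h1
  rw [← fderiv_biFun, h1.fderiv]
  rfl

theorem isZariskiDense_diagonal {U : Set (Fin m → ℂ)} {p : Fin m → ℂ} (hU : U ∈ 𝓝 p) :
    IsZariskiDense {x : Fin m ⊕ Fin m → ℂ | ∃ z ∈ U, x = Sum.elim z (star z)} := by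
  obtain ⟨ε, hε, hb⟩ := Metric.mem_nhds_iff.1 hU
  intro c hc
  let φ : MvPolynomial (Fin m ⊕ Fin m) ℂ →ₐ[ℂ] MvPolynomial (Fin m ⊕ Fin m) ℂ :=
    aeval (Sum.elim (fun i => X (Sum.inl i) + C I * X (Sum.inr i))
      (fun i => X (Sum.inl i) - C I * X (Sum.inr i)))
  have hφ : ∀ a b : Fin m → ℂ, eval (Sum.elim a b) (φ c) =
      eval (Sum.elim (a + I • b) (a - I • b)) c := by
    intro a b
    have : (eval (Sum.elim a b)).comp φ.toRingHom = eval (Sum.elim (a + I • b) (a - I • b)) := by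
      refine MvPolynomial.ringHom_ext (by simp [φ]) ?_
      rintro (i | i) <;> simp [φ]
    exact congrArg (fun ψ => ψ c) this
  have h0 : φ c = 0 := by
    refine funext_set (Sum.elim (fun i => ofReal '' Metric.ball (p i).re (ε / 2))
      (fun i => ofReal '' Metric.ball (p i).im (ε / 2))) ?_ fun y hy => ?_
    · rintro (i | i) <;>
      exact (infinite_of_mem_nhds _ (Metric.ball_mem_nhds _ (half_pos hε))).image
        ofReal_injective.injOn
    · have ha : ∀ i, ∃ a : ℝ, a ∈ Metric.ball (p i).re (ε / 2) ∧ (a : ℂ) = y (Sum.inl i) :=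
        fun i => hy (Sum.inl i) trivial
      have hb' : ∀ i, ∃ b : ℝ, b ∈ Metric.ball (p i).im (ε / 2) ∧ (b : ℂ) = y (Sum.inr i) :=
        fun i => hy (Sum.inr i) trivial
      choose a ha1 ha2 using ha
      choose b hb1 hb2 using hb'
      have hy' : y = Sum.elim (fun i => (a i : ℂ)) (fun i => (b i : ℂ)) := by
        ext i
        rcases i with i | i <;> simp [ha2, hb2]
      rw [map_zero, hy', hφ]
      refine hc _ ⟨(fun i => (a i : ℂ)) + I • fun i => (b i : ℂ), hb ?_, ?_⟩
      · rw [ball_pi _ hε]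
        intro i _
        have h1 := ha1 i
        have h2 := hb1 i
        rw [Metric.mem_ball, Real.dist_eq] at h1 h2
        rw [Metric.mem_ball, dist_eq_norm]
        refine (Complex.norm_le_abs_re_add_abs_im _).trans_lt ?_
        simp
        linarith
      · congr 1
        ext i
        simp [Complex.ext_iff]
  refine MvPolynomial.funext fun x => ?_
  have h1 := hφ (fun i => (x (Sum.inl i) + x (Sum.inr i)) / 2)
    (fun i => (x (Sum.inl i) - x (Sum.inr i)) / (2 * I))
  rw [h0, map_zero] at h1
  rw [map_zero, h1]
  congr 2
  ext i
  rcases i with i | i <;> simp <;> field_simp <;> ring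

end Diagonal

section HermitianPolynomial

open MvPolynomial
open scoped Topology ContDiff

variable {m : ℕ}

/-- `Q(z, ζ)` is Hermitian symmetric: it is real on the diagonal `ζ = z̄`. -/
def IsHermitianPoly (Q : MvPolynomial (Fin m ⊕ Fin m) ℂ) : Prop :=
  ∀ z ζ, star (biEval Q z ζ) = biEval Q (star ζ) (star z)

variable {Q : MvPolynomial (Fin m ⊕ Fin m) ℂ}

theorem IsHermitianPoly.im_eq_zero (hQ : IsHermitianPoly Q) (z : Fin m → ℂ) :
    (biFun Q (z, star z)).im = 0 := by
  have h := hQ z (star z)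
  rw [star_star] at h
  exact Complex.conj_eq_iff_im.1 h

theorem differentiable_biFun (Q : MvPolynomial (Fin m ⊕ Fin m) ℂ) : Differentiable ℂ (biFun Q) :=
  (contDiff_biFun (n := 1) Q).differentiable (by norm_num)

theorem continuous_biFun (Q : MvPolynomial (Fin m ⊕ Fin m) ℂ) : Continuous (biFun Q) :=
  (differentiable_biFun Q).continuous

theorem fderiv_biFun_diag (hQ : IsHermitianPoly Q) {p ν : Fin m → ℂ}
    (hν : fderiv ℂ (biFun Q) (p, star p) (ν, 0) = 1) :
    fderiv ℂ (biFun Q) (p, star p) (ν, star ν) = 2 := by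
  have h : (ν, star ν) = (ν, (0 : Fin m → ℂ)) + ((0 : Fin m → ℂ), star ν) := by simp
  rw [h, map_add, fderiv_snd_eq_star (differentiable_biFun Q) hQ.im_eq_zero, hν]
  norm_num

/-- Near a smooth point, polynomial relations valid on the real hypersurface
`Q(z, z̄) = 0` extend to its complexification `Q(z, ζ) = 0`. -/
theorem exists_nhds_forall_vanish_of_diagonal (hQ : IsHermitianPoly Q) {p ν : Fin m → ℂ}
    (h0 : biEval Q p (star p) = 0) (hν : fderiv ℂ (biFun Q) (p, star p) (ν, 0) = 1) :
    ∃ N ∈ 𝓝 (p, star p), ∀ Λ : MvPolynomial (Fin m ⊕ Fin m) ℂ,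
      (∀ᶠ z in 𝓝 p, biEval Q z (star z) = 0 → biEval Λ z (star z) = 0) →
      ∀ x ∈ N, biFun Q x = 0 → biFun Λ x = 0 := by
  have h2 := fderiv_biFun_diag hQ hν
  have hd : eval (Sum.elim p (star p)) (dirDeriv (Sum.elim ν (star ν)) Q) ≠ 0 := by
    rw [fderiv_biFun] at h2
    change eval _ _ = _ at h2
    rw [h2]
    norm_num
  obtain ⟨f, h, hf, hfh, hfp, hhp, hfd⟩ := exists_irreducible_factor_of_deriv_ne_zero h0 hd
  refine ⟨{x | biFun h x ≠ 0}, (isOpen_ne_fun (continuous_biFun h) continuous_const).mem_nhds hhp,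
    fun Λ hΛ x hx hQx => ?_⟩
  have hfx : biFun f x = 0 := by
    have : biFun Q x = biFun f x * biFun h x := by simp [biFun, biEval, hfh]
    rw [this] at hQx
    exact (mul_eq_zero.1 hQx).resolve_right hx
  have hR : ContDiffAt ℝ 1 (diagRe (biFun Q)) p :=
    (reCLM.contDiff.comp (((contDiff_biFun Q).restrict_scalars ℝ).comp
      (conjGraph m).contDiff)).contDiffAt
  have hR0 : diagRe (biFun Q) p = 0 := by
    change (biEval Q p (star p)).re = 0
    rw [h0, zero_re]
  have hRd : fderiv ℝ (diagRe (biFun Q)) p ν ≠ 0 := by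
    rw [fderiv_diagRe (differentiable_biFun Q), h2]
    norm_num
  obtain ⟨θ, hθ, hθ0, hz, -⟩ := exists_directional_implicit one_ne_zero hR hR0 hRd
  have hG : Filter.Tendsto (fun z => z + θ z • ν) (𝓝 p) (𝓝 p) := by
    have h : ContinuousAt (fun z => z + θ z • ν) p := by
      have := hθ.continuousAt
      fun_prop
    simpa [hθ0] using h.tendsto
  have hh : ∀ᶠ z in 𝓝 p, biEval h z (star z) ≠ 0 := by
    have : Continuous fun z : Fin m → ℂ => biFun h (z, star z) :=
      (continuous_biFun h).comp (by fun_prop)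
    exact (isOpen_ne_fun this continuous_const).mem_nhds hhp
  have hU := hz.and ((hG.eventually hΛ).and (hG.eventually hh))
  have hdvd : f ∣ Λ := by
    refine dvd_of_common_zeros hf (natDegree_lineSubst_ne_zero_of_deriv hfd)
      (isZariskiDense_diagonal hU) ?_
    rintro _ ⟨z, ⟨hz1, hz2, hz3⟩, rfl⟩
    have e : Sum.elim z (star z) + (θ z : ℂ) • Sum.elim ν (star ν) =
        Sum.elim (z + θ z • ν) (star (z + θ z • ν)) := by
      ext i
      rcases i with i | i <;> simp
    have hQz : biEval Q (z + θ z • ν) (star (z + θ z • ν)) = 0 :=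
      Complex.ext hz1 (hQ.im_eq_zero _)
    refine ⟨θ z, ?_, ?_⟩
    · rw [e]
      rw [biEval, hfh, map_mul] at hQz
      exact (mul_eq_zero.1 hQz).resolve_right hz3
    · rw [e]
      exact hz2 hQz
  obtain ⟨k, rfl⟩ := hdvd
  have : biFun (f * k) x = biFun f x * biFun k x := by simp [biFun, biEval]
  rw [this, hfx, zero_mul]

/-- A sesquilinear form is determined by its diagonal. -/
theorem eq_zero_of_sesquilinear_diag {H : (Fin m → ℂ) → (Fin m → ℂ) → ℂ}
    (hl : ∀ u u' b, H (u + u') b = H u b + H u' b) (hr : ∀ u b b', H u (b + b') = H u b + H u b')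
    (hsl : ∀ (c : ℂ) u b, H (c • u) b = c * H u b) (hsr : ∀ (c : ℂ) u b, H u (c • b) = c * H u b)
    (h : ∀ u, H u (star u) = 0) (u b : Fin m → ℂ) : H u b = 0 := by
  have h1 := h (u + star b)
  have h2 := h (u + I • star b)
  simp only [star_add, star_smul, star_star, hl, hr, hsl, hsr, h] at h1 h2
  have h3 := h (star b)
  rw [star_star] at h3
  rw [h3] at h1 h2
  simp only [RCLike.star_def, conj_I] at h2
  have : H u b * (2 * I) = 0 := by linear_combination I * h1 - h2
  simpa using this

/-- `M`, near each of its points close to `p`, contains the zeros of `Q(z, z̄)` and is Levi flat. -/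
def IsLeviFlatNear (Q : MvPolynomial (Fin m ⊕ Fin m) ℂ) (p : Fin m → ℂ) : Prop :=
  ∀ᶠ q in 𝓝 p, biEval Q q (star q) = 0 → ∃ ρ : (Fin m → ℂ) → ℝ, ContDiffAt ℝ 2 ρ q ∧
    fderiv ℝ ρ q ≠ 0 ∧ (∀ᶠ z in 𝓝 q, biEval Q z (star z) = 0 → ρ z = 0) ∧
    ∀ w, IsComplexTangent ρ q w → leviForm ρ q w = 0

/-- The complexification of a Levi-flat hypersurface splits as a product of leaves. -/
theorem eventually_biEval_eq_zero_of_leviFlat (hQ : IsHermitianPoly Q) {p ν : Fin m → ℂ}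
    (h0 : biEval Q p (star p) = 0) (hν : fderiv ℂ (biFun Q) (p, star p) (ν, 0) = 1)
    (hL : IsLeviFlatNear Q p) :
    ∀ᶠ x : (Fin m → ℂ) × (Fin m → ℂ) in 𝓝 (p, star p),
      biEval Q x.1 (star p) = 0 → biEval Q p x.2 = 0 → biEval Q x.1 x.2 = 0 := by
  obtain ⟨N, hN, hN'⟩ := exists_nhds_forall_vanish_of_diagonal hQ h0 hν
  have hν' : fderiv ℂ (biFun Q) (p, star p) (0, star ν) ≠ 0 := by
    rw [fderiv_snd_eq_star (differentiable_biFun Q) hQ.im_eq_zero, hν]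
    simp
  have hν0 : fderiv ℂ (biFun Q) (p, star p) (ν, 0) ≠ 0 := by
    rw [hν]
    exact one_ne_zero
  refine eventually_eq_zero_of_levi_flat (F := biFun Q) (contDiff_biFun Q) h0 hν0 hν' ?_
  let H : (Fin m → ℂ) × (Fin m → ℂ) → (Fin m → ℂ) → (Fin m → ℂ) → ℂ := fun x u b =>
    fderiv ℂ (fderiv ℂ (biFun Q)) x
      (fderiv ℂ (biFun Q) x (ν, 0) • u - fderiv ℂ (biFun Q) x (u, 0) • ν, 0)
      (0, fderiv ℂ (biFun Q) x (0, star ν) • b - fderiv ℂ (biFun Q) x (0, b) • star ν)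
  have hH : ∀ x u b, H x u b = fderiv ℂ (fderiv ℂ (biFun Q)) x
      (fderiv ℂ (biFun Q) x (ν, 0) • (u, 0) - fderiv ℂ (biFun Q) x (u, 0) • (ν, 0))
      (fderiv ℂ (biFun Q) x (0, star ν) • (0, b) -
        fderiv ℂ (biFun Q) x (0, b) • (0, star ν)) := by
    intro x u b
    simp [H]
  have hHN : ∀ x ∈ N, biFun Q x = 0 → ∀ u, H x u (star u) = 0 := by
    intro x hx hQx u
    let d₁ : (Fin m → ℂ) → MvPolynomial (Fin m ⊕ Fin m) ℂ := fun u => dirDeriv (Sum.elim u 0) Q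
    let d₂ : (Fin m → ℂ) → MvPolynomial (Fin m ⊕ Fin m) ℂ := fun u => dirDeriv (Sum.elim 0 u) Q
    let d₁₂ : (Fin m → ℂ) → (Fin m → ℂ) → MvPolynomial (Fin m ⊕ Fin m) ℂ := fun u b =>
      dirDeriv (Sum.elim u 0) (dirDeriv (Sum.elim 0 b) Q)
    let Λ : MvPolynomial (Fin m ⊕ Fin m) ℂ := d₁ ν * d₂ (star ν) * d₁₂ u (star u) -
      d₁ ν * d₂ (star u) * d₁₂ u (star ν) - d₁ u * d₂ (star ν) * d₁₂ ν (star u) +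
      d₁ u * d₂ (star u) * d₁₂ ν (star ν)
    have hΛ : ∀ x, biFun Λ x = H x u (star u) := by
      intro x
      rw [hH]
      simp only [map_sub, map_smul, sub_apply, smul_apply, smul_eq_mul]
      simp only [fderiv_biFun, fderiv_fderiv_biFun]
      simp only [biFun, biEval, Λ, d₁, d₂, d₁₂, map_sub, map_add, map_mul]
      ring
    rw [← hΛ]
    refine hN' Λ ?_ x hx hQx
    have hc : ∀ᶠ q in 𝓝 p, fderiv ℂ (biFun Q) (q, star q) (ν, 0) ≠ 0 := by
      have : Continuous fun q : Fin m → ℂ => fderiv ℂ (biFun Q) (q, star q) (ν, 0) := by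
        simp only [fderiv_biFun]
        exact (continuous_biFun _).comp (by fun_prop)
      exact (isOpen_ne_fun this continuous_const).mem_nhds hν0
    filter_upwards [hL, hc] with q hq hqν hQq
    obtain ⟨ρ, hρ, hρd, hsub, hlevi⟩ := hq hQq
    change biFun Λ (q, star q) = 0
    rw [hΛ]
    have e : fderiv ℂ (biFun Q) (q, star q) (0, star ν) • star u -
        fderiv ℂ (biFun Q) (q, star q) (0, star u) • star ν =
        star (fderiv ℂ (biFun Q) (q, star q) (ν, 0) • u -
          fderiv ℂ (biFun Q) (q, star q) (u, 0) • ν) := by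
      rw [fderiv_snd_eq_star (differentiable_biFun Q) hQ.im_eq_zero,
        fderiv_snd_eq_star (differentiable_biFun Q) hQ.im_eq_zero]
      simp
    simp only [H]
    rw [e]
    refine levi_eq_zero_of_hypersurface (contDiff_biFun Q) hQ.im_eq_zero hQq ⟨ν, hqν⟩ hρ hρd hsub
      hlevi ?_
    have e' : (fderiv ℂ (biFun Q) (q, star q) (ν, 0) • u -
          fderiv ℂ (biFun Q) (q, star q) (u, 0) • ν, (0 : Fin m → ℂ)) =
        fderiv ℂ (biFun Q) (q, star q) (ν, 0) • (u, (0 : Fin m → ℂ)) -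
          fderiv ℂ (biFun Q) (q, star q) (u, 0) • (ν, (0 : Fin m → ℂ)) := by simp
    rw [e', map_sub, map_smul, map_smul, smul_eq_mul, smul_eq_mul, mul_comm, sub_self]
  filter_upwards [hN] with x hx hQx u b
  have hl : ∀ u u' : Fin m → ℂ, (u + u', (0 : Fin m → ℂ)) = (u, 0) + (u', 0) := by simp
  have hr : ∀ u u' : Fin m → ℂ, ((0 : Fin m → ℂ), u + u') = (0, u) + (0, u') := by simp
  have hsl : ∀ (c : ℂ) (u : Fin m → ℂ), (c • u, (0 : Fin m → ℂ)) = c • (u, 0) := by simp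
  have hsr : ∀ (c : ℂ) (u : Fin m → ℂ), ((0 : Fin m → ℂ), c • u) = c • (0, u) := by simp
  refine eq_zero_of_sesquilinear_diag (H := H x) ?_ ?_ ?_ ?_ (hHN x hx hQx) u b
  · intro u u' b
    simp only [hH, hl, map_sub, map_add, map_smul, sub_apply, smul_apply, add_apply, smul_eq_mul]
    ring
  · intro u b b'
    simp only [hH, hr, map_sub, map_add, map_smul, sub_apply, smul_apply, smul_eq_mul]
    ring
  · intro c u b
    simp only [hH, hsl, map_sub, map_smul, sub_apply, smul_apply, smul_eq_mul]
    ring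
  · intro c u b
    simp only [hH, hsr, map_sub, map_smul, sub_apply, smul_apply, smul_eq_mul]
    ring

end HermitianPolynomial

section SmoothZeros

open MvPolynomial
open scoped Topology ContDiff

variable {τ : Type*} [Fintype τ]

/-- An irreducible polynomial divides every polynomial vanishing on its zero set near a smooth
point. -/
theorem dvd_of_eventually_vanish {f g : MvPolynomial τ ℂ} (hf : Irreducible f) {p ν : τ → ℂ}
    (hp : eval p f = 0) (hν : eval p (dirDeriv ν f) ≠ 0)
    (h : ∀ᶠ r in 𝓝 p, eval r f = 0 → eval r g = 0) : f ∣ g := by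
  have hd : fderiv ℂ (fun x => eval x f) p ν ≠ 0 := by rwa [fderiv_eval]
  obtain ⟨θ, hθ, hθ0, hz, -⟩ := exists_directional_implicit one_ne_zero
    (contDiff_eval (n := 1) f).contDiffAt hp hd
  have hG : Filter.Tendsto (fun z => z + θ z • ν) (𝓝 p) (𝓝 p) := by
    have h : ContinuousAt (fun z => z + θ z • ν) p := by
      have := hθ.continuousAt
      fun_prop
    simpa [hθ0] using h.tendsto
  exact dvd_of_common_zeros hf (natDegree_lineSubst_ne_zero_of_deriv hν)
    (isZariskiDense_of_mem_nhds (hz.and (hG.eventually h))) fun y hy => ⟨θ y, hy.1, hy.2 hy.1⟩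

end SmoothZeros

section LeafPolynomials

open MvPolynomial
open scoped Topology ContDiff

variable {m : ℕ} {Q : MvPolynomial (Fin m ⊕ Fin m) ℂ}

/-- `Q(·, ζ)` as a polynomial in the first group of variables. -/
def fixSnd (ζ : Fin m → ℂ) (Q : MvPolynomial (Fin m ⊕ Fin m) ℂ) : MvPolynomial (Fin m) ℂ :=
  aeval (Sum.elim X fun i => C (ζ i)) Q

theorem eval_fixSnd (z ζ : Fin m → ℂ) (Q : MvPolynomial (Fin m ⊕ Fin m) ℂ) :
    eval z (fixSnd ζ Q) = biEval Q z ζ := by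
  have : (eval z).comp (aeval (R := ℂ) (Sum.elim X fun i => C (ζ i)) :
      MvPolynomial (Fin m ⊕ Fin m) ℂ →ₐ[ℂ] MvPolynomial (Fin m) ℂ).toRingHom =
      eval (Sum.elim z ζ) := by
    refine MvPolynomial.ringHom_ext (by simp) ?_
    rintro (i | i) <;> simp
  exact congrArg (fun ψ => ψ Q) this

theorem eval_dirDeriv_fixSnd (z ζ ν : Fin m → ℂ) (Q : MvPolynomial (Fin m ⊕ Fin m) ℂ) :
    eval z (dirDeriv ν (fixSnd ζ Q)) = fderiv ℂ (biFun Q) (z, ζ) (ν, 0) := by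
  rw [← fderiv_eval]
  have h1 : HasFDerivAt (fun z : Fin m → ℂ => (z, ζ)) (ContinuousLinearMap.inl ℂ _ _) z :=
    hasFDerivAt_prodMk_left z ζ
  have h2 := ((differentiable_biFun Q) (z, ζ)).hasFDerivAt.comp z h1
  have h3 : (biFun Q ∘ fun z => (z, ζ)) = fun z => eval z (fixSnd ζ Q) :=
    funext fun z => (eval_fixSnd z ζ Q).symm
  rw [h3] at h2
  rw [h2.fderiv]
  simp

/-- The polynomial `f` defines a complex hypersurface contained in `Q(z, z̄) = 0`, in the strong
sense that `Q(r, z̄) = 0` for all of its points `z`, `r`. -/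
structure IsLeafPoly (Q : MvPolynomial (Fin m ⊕ Fin m) ℂ) (f : MvPolynomial (Fin m) ℂ) :
    Prop where
  irreducible : Irreducible f
  dvd_fixSnd : ∀ z, eval z f = 0 → f ∣ fixSnd (star z) Q

theorem IsLeafPoly.biEval_eq_zero {f : MvPolynomial (Fin m) ℂ} (hf : IsLeafPoly Q f)
    {z : Fin m → ℂ} (hz : eval z f = 0) : biEval Q z (star z) = 0 := by
  obtain ⟨k, hk⟩ := hf.dvd_fixSnd z hz
  rw [← eval_fixSnd, hk, map_mul, hz, zero_mul]

/-- The Levi leaf through a smooth point is algebraic. -/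
theorem exists_isLeafPoly (hQ : IsHermitianPoly Q) {p ν : Fin m → ℂ}
    (h0 : biEval Q p (star p) = 0) (hν : fderiv ℂ (biFun Q) (p, star p) (ν, 0) = 1)
    (hL : IsLeviFlatNear Q p) :
    ∃ f, IsLeafPoly Q f ∧ eval p f = 0 ∧ eval p (dirDeriv ν f) ≠ 0 := by
  obtain ⟨f, h, hf, hfh, hfp, -, hfd⟩ := exists_irreducible_factor_of_deriv_ne_zero
    (Q := fixSnd (star p) Q) (x := p) (v := ν) (by rwa [eval_fixSnd])
    (by rw [eval_dirDeriv_fixSnd, hν]; exact one_ne_zero)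
  have hfQ : ∀ r, eval r f = 0 → biEval Q r (star p) = 0 := fun r hr => by
    rw [← eval_fixSnd, hfh, map_mul, hr, zero_mul]
  have hconj : ∀ a b, biEval Q a (star b) = 0 → biEval Q b (star a) = 0 := fun a b h => by
    have := hQ a (star b)
    rw [h, star_zero, star_star] at this
    exact this.symm
  have hG := eventually_biEval_eq_zero_of_leviFlat hQ h0 hν hL
  rw [nhds_prod_eq, Filter.eventually_prod_iff] at hG
  obtain ⟨pa, hpa, pb, hpb, hab⟩ := hG
  have hA : ∀ ζ, pb ζ → biEval Q p ζ = 0 → f ∣ fixSnd ζ Q := fun ζ hζ hpζ => by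
    refine dvd_of_eventually_vanish hf hfp hfd ?_
    filter_upwards [hpa] with r hr hfr
    rw [eval_fixSnd]
    exact hab hr hζ (hfQ r hfr) hpζ
  have hstar : ∀ᶠ r : Fin m → ℂ in 𝓝 p, pb (star r) :=
    (continuous_star.tendsto p).eventually hpb
  refine ⟨f, ⟨hf, fun z hz => dvd_of_eventually_vanish hf hfp hfd ?_⟩, hfp, hfd⟩
  filter_upwards [hstar] with r hr hfr
  rw [eval_fixSnd]
  refine hconj _ _ ?_
  obtain ⟨k, hk⟩ := hA (star r) hr (hconj _ _ (hfQ r hfr))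
  rw [← eval_fixSnd, hk, map_mul, hz, zero_mul]

/-- The leaf through a smooth point does not contain the whole hypersurface near that point. -/
theorem frequently_eval_ne_zero (hQ : IsHermitianPoly Q) {p ν : Fin m → ℂ}
    (h0 : biEval Q p (star p) = 0) (hν : fderiv ℂ (biFun Q) (p, star p) (ν, 0) = 1)
    {f : MvPolynomial (Fin m) ℂ} (hfp : eval p f = 0) (hf : eval p (dirDeriv ν f) ≠ 0) :
    ∃ᶠ q in 𝓝 p, biEval Q q (star q) = 0 ∧ eval q f ≠ 0 := by
  intro hcon
  have hR : ContDiffAt ℝ 1 (diagRe (biFun Q)) p :=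
    (reCLM.contDiff.comp (((contDiff_biFun Q).restrict_scalars ℝ).comp
      (conjGraph m).contDiff)).contDiffAt
  have hR0 : diagRe (biFun Q) p = 0 := by
    change (biEval Q p (star p)).re = 0
    rw [h0, zero_re]
  have hRd : fderiv ℝ (diagRe (biFun Q)) p ν ≠ 0 := by
    rw [fderiv_diagRe (differentiable_biFun Q), fderiv_biFun_diag hQ hν]
    norm_num
  obtain ⟨θ, hθ, hθ0, hz, -⟩ := exists_directional_implicit one_ne_zero hR hR0 hRd
  have hG : Filter.Tendsto (fun z => z + θ z • ν) (𝓝 p) (𝓝 p) := by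
    have h : ContinuousAt (fun z => z + θ z • ν) p := by
      have := hθ.continuousAt
      fun_prop
    simpa [hθ0] using h.tendsto
  have hline : Filter.Tendsto (fun t : ℝ => p + ((t : ℂ) * I) • ν) (𝓝 0) (𝓝 p) := by
    have h : Continuous fun t : ℝ => p + ((t : ℂ) * I) • ν := by fun_prop
    simpa using h.tendsto 0
  have hev := hline.eventually (hz.and (hG.eventually hcon))
  let φ : ℝ → ℂ := fun t => θ (p + ((t : ℂ) * I) • ν) + t * I
  have hφ : Function.Injective φ := fun s t hst => by
    have := congrArg Complex.im hst
    simpa [φ] using this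
  have hroot : ∀ᶠ t : ℝ in 𝓝 0, ((lineSubst ν f).map (eval p)).IsRoot (φ t) := by
    filter_upwards [hev] with t ⟨ht1, ht2⟩
    rw [Polynomial.IsRoot, eval_map_lineSubst]
    have e : p + φ t • ν = (p + ((t : ℂ) * I) • ν) + θ (p + ((t : ℂ) * I) • ν) • ν := by
      ext i
      simp [φ]
      ring
    rw [e]
    by_contra hne
    exact ht2 ⟨Complex.ext ht1 (hQ.im_eq_zero _), hne⟩
  have hzero := Polynomial.eq_zero_of_infinite_isRoot _
    (((infinite_of_mem_nhds (0 : ℝ) hroot).image hφ.injOn).mono (image_subset_iff.2 fun _ h => h))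
  obtain ⟨w, hw⟩ := exists_eval_ne_of_deriv hf
  refine hw ?_
  rw [← eval_map_lineSubst, hzero, Polynomial.eval_zero, hfp]

theorem not_dvd_fixSnd_mul {p ν : Fin m → ℂ}
    (hν : fderiv ℂ (biFun Q) (p, star p) (ν, 0) = 1) {f g : MvPolynomial (Fin m) ℂ}
    (hf : eval p f = 0) (hg : eval p g = 0) : ¬ f * g ∣ fixSnd (star p) Q := by
  rintro ⟨k, hk⟩
  have := eval_dirDeriv_fixSnd p (star p) ν Q
  rw [hν, hk] at this
  simp [Derivation.leibniz, hf, hg] at this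

/-- A leaf of a homogeneous `Q` passes through the origin. -/
theorem eval_zero_of_dvd_homogeneous {f q : MvPolynomial (Fin m) ℂ} {D : ℕ} (hfq : f ∣ q)
    (hq0 : q ≠ 0) (hq : ∀ (t : ℂ) u, eval (t • u) q = t ^ D * eval u q) {p : Fin m → ℂ}
    (hp : eval p f = 0) : eval 0 f = 0 := by
  by_contra h0
  obtain ⟨k, hk⟩ := hfq
  have hu : ∀ u, eval u q ≠ 0 → eval u f = eval 0 f := by
    intro u hu
    have hroot : ∀ t, ¬ ((lineSubst u f).map (eval 0)).IsRoot t := by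
      intro t ht
      rw [Polynomial.IsRoot, eval_map_lineSubst, zero_add] at ht
      have h1 := hq t u
      rw [hk, map_mul, ht, zero_mul, ← hk] at h1
      rcases mul_eq_zero.1 h1.symm with h2 | h2
      · rw [eq_zero_of_pow_eq_zero h2, zero_smul] at ht
        exact h0 ht
      · exact hu h2
    have hdeg : ((lineSubst u f).map (eval 0)).degree = 0 := by
      by_contra hd
      obtain ⟨t, ht⟩ := IsAlgClosed.exists_root _ hd
      exact hroot t ht
    obtain ⟨c, hc⟩ := Polynomial.natDegree_eq_zero.1
      (Polynomial.natDegree_eq_of_degree_eq_some hdeg)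
    have h1 := eval_map_lineSubst u 0 1 f
    have h2 := eval_map_lineSubst u 0 0 f
    rw [← hc, Polynomial.eval_C] at h1 h2
    simp only [one_smul, zero_smul, zero_add] at h1 h2
    rw [← h1, h2]
  have hz : (f - C (eval 0 f)) * q = 0 := MvPolynomial.funext fun u => by
    rw [map_mul, map_sub, eval_C, map_zero]
    by_cases h : eval u q = 0
    · rw [h, mul_zero]
    · rw [hu u h, sub_self, zero_mul]
  have hfc := sub_eq_zero.1 ((mul_eq_zero.1 hz).resolve_right hq0)
  rw [hfc, eval_C] at hp
  exact h0 hp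

end LeafPolynomials

section TopForm

open MvPolynomial
open scoped Topology

variable {τ : Type*}

/-- The top homogeneous component of `f`. -/
def topForm (f : MvPolynomial τ ℂ) : MvPolynomial τ ℂ :=
  homogeneousComponent f.totalDegree f

theorem topForm_ne_zero {f : MvPolynomial τ ℂ} (hf : f ≠ 0) : topForm f ≠ 0 := by
  intro h
  obtain ⟨d, hd, hd'⟩ : ∃ d ∈ f.support, d.degree = f.totalDegree := by
    have := Finset.exists_mem_eq_sup f.support (support_nonempty.2 hf) fun d => d.degree
    obtain ⟨d, h1, h2⟩ := this
    exact ⟨d, h1, h2.symm⟩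
  have h1 := congrArg (coeff d) h
  rw [topForm, coeff_homogeneousComponent, if_pos hd', coeff_zero] at h1
  exact (mem_support_iff.1 hd) h1

theorem exists_eval_ne_zero {f : MvPolynomial τ ℂ} (hf : f ≠ 0) : ∃ v, eval v f ≠ 0 := by
  by_contra! h
  exact hf (MvPolynomial.funext fun v => by rw [h, map_zero])

variable {f : MvPolynomial τ ℂ} {v : τ → ℂ}

theorem natDegree_lineSubst_eq (hv : eval v (topForm f) ≠ 0) :
    (lineSubst v f).natDegree = f.totalDegree := by
  refine le_antisymm (natDegree_lineSubst_le v f) (Polynomial.le_natDegree_of_ne_zero ?_)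
  rw [coeff_lineSubst_totalDegree]
  exact (map_ne_zero_iff _ (C_injective _ _)).2 hv

theorem natDegree_map_lineSubst_eq (hv : eval v (topForm f) ≠ 0) (y : τ → ℂ) :
    ((lineSubst v f).map (eval y)).natDegree = f.totalDegree := by
  refine le_antisymm (Polynomial.natDegree_map_le.trans (natDegree_lineSubst_le v f))
    (Polynomial.le_natDegree_of_ne_zero ?_)
  rw [Polynomial.coeff_map, coeff_lineSubst_totalDegree, eval_C]
  exact hv

theorem leadingCoeff_map_lineSubst_eq (hv : eval v (topForm f) ≠ 0) (y : τ → ℂ) :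
    ((lineSubst v f).map (eval y)).leadingCoeff = eval v (topForm f) := by
  rw [Polynomial.leadingCoeff, natDegree_map_lineSubst_eq hv, Polynomial.coeff_map,
    coeff_lineSubst_totalDegree, eval_C]
  rfl

theorem totalDegree_ne_zero_of_irreducible {f : MvPolynomial τ ℂ} (hf : Irreducible f) :
    f.totalDegree ≠ 0 := by
  intro h
  have h1 := totalDegree_eq_zero_iff_eq_C.1 h
  refine hf.not_isUnit ?_
  rw [h1] at hf ⊢
  refine (IsUnit.mk0 _ ?_).map C
  rintro h0
  exact hf.ne_zero (by rw [h0, C_0])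

theorem exists_root_norm_lt {p : Polynomial ℂ} {ε : ℝ} (hε : 0 < ε)
    (h : ‖p.eval 0‖ < ‖p.leadingCoeff‖ * ε ^ p.natDegree) : ∃ w, p.IsRoot w ∧ ‖w‖ < ε := by
  by_contra! hcon
  have hs := IsAlgClosed.splits p
  have hp : p ≠ 0 := by
    rintro rfl
    simp at h
  rw [hs.eval_eq_prod_roots, norm_mul, hs.natDegree_eq_card_roots] at h
  have hprod : ∀ s : Multiset ℂ, (∀ w ∈ s, ε ≤ ‖w‖) →
      ε ^ s.card ≤ ‖(s.map fun w => (0 : ℂ) - w).prod‖ := by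
    intro s
    induction s using Multiset.induction_on with
    | empty => simp
    | cons a s ih =>
      intro hs
      rw [Multiset.map_cons, Multiset.prod_cons, Multiset.card_cons, norm_mul, pow_succ']
      refine mul_le_mul ?_ (ih fun w hw => hs w (Multiset.mem_cons_of_mem hw)) (by positivity)
        (norm_nonneg _)
      rw [zero_sub, norm_neg]
      exact hs a (Multiset.mem_cons_self a s)
  have := hprod p.roots fun w hw => hcon w ((Polynomial.mem_roots hp).1 hw)
  exact absurd h (not_lt.2 (mul_le_mul_of_nonneg_left this (norm_nonneg _)))

/-- The zero set of an irreducible polynomial `f` is the closure of the complement in it of the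
zero set of a polynomial not divisible by `f`. -/
theorem mem_closure_of_irreducible [Fintype τ] {g : MvPolynomial τ ℂ}
    (hf : Irreducible f) (hfg : ¬ f ∣ g) {x : τ → ℂ} (hx : eval x f = 0) :
    x ∈ closure {z | eval z f = 0 ∧ eval z g ≠ 0} := by
  by_contra hcl
  have hev : ∀ᶠ z in 𝓝 x, eval z f = 0 → eval z g = 0 := by
    filter_upwards [isClosed_closure.isOpen_compl.mem_nhds hcl] with z hz hfz
    by_contra hne
    exact hz (subset_closure ⟨hfz, hne⟩)
  obtain ⟨v, hv⟩ := exists_eval_ne_zero (topForm_ne_zero hf.ne_zero)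
  have hd := totalDegree_ne_zero_of_irreducible hf
  have hT : Filter.Tendsto (fun q : (τ → ℂ) × ℂ => q.1 + q.2 • v) (𝓝 (x, 0)) (𝓝 x) := by
    have h : Continuous fun q : (τ → ℂ) × ℂ => q.1 + q.2 • v := by fun_prop
    simpa using h.tendsto (x, 0)
  have hev2 := hT.eventually hev
  rw [nhds_prod_eq, Filter.eventually_prod_iff] at hev2
  obtain ⟨pa, hpa, pb, hpb, hab⟩ := hev2
  obtain ⟨ε, hε, hb⟩ := Metric.eventually_nhds_iff.1 hpb
  have hsmall : ∀ᶠ y in 𝓝 x, ‖eval y f‖ < ‖eval v (topForm f)‖ * ε ^ f.totalDegree := by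
    have hc : Continuous fun y => ‖eval y f‖ := (continuous_eval_mv f).norm
    refine (isOpen_lt hc continuous_const).mem_nhds ?_
    change ‖eval x f‖ < _
    rw [hx, norm_zero]
    have := norm_pos_iff.2 hv
    positivity
  refine hfg (dvd_of_common_zeros hf (v := v) (by rwa [natDegree_lineSubst_eq hv])
    (isZariskiDense_of_mem_nhds (hpa.and hsmall)) ?_)
  rintro y ⟨hy1, hy2⟩
  obtain ⟨w, hw, hwε⟩ := exists_root_norm_lt (p := (lineSubst v f).map (eval y)) hε (by
    rw [eval_map_lineSubst, zero_smul, add_zero, leadingCoeff_map_lineSubst_eq hv,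
      natDegree_map_lineSubst_eq hv]
    exact hy2)
  rw [Polynomial.IsRoot, eval_map_lineSubst] at hw
  exact ⟨w, hw, hab hy1 (hb (by rwa [dist_zero_right])) hw⟩

end TopForm

section TwoLeaves

open MvPolynomial
open scoped Topology

variable {n : ℕ}

/-- The properties of the cone over an algebraic Levi-flat hypersurface in `ℂℙⁿ` which lead to a
contradiction. -/
structure IsAlgebraicLeviFlat (Q : MvPolynomial (Fin (n + 1) ⊕ Fin (n + 1)) ℂ)
    (M : Set (Fin (n + 1) → ℂ)) : Prop where
  hermitian : IsHermitianPoly Q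
  homogeneous : ∃ D : ℕ, ∀ (t : ℂ) z ζ, biEval Q (t • z) ζ = t ^ D * biEval Q z ζ
  mem_iff : ∀ z, z 0 ≠ 0 → (z ∈ M ↔ biEval Q z (star z) = 0)
  mem_of_mem_closure : ∀ z ∈ closure M, z ≠ 0 → z ∈ M
  smooth : ∀ p, p 0 ≠ 0 → biEval Q p (star p) = 0 →
    ∃ ν, fderiv ℂ (biFun Q) (p, star p) (ν, 0) = 1
  leviFlat : ∀ p, p 0 ≠ 0 → biEval Q p (star p) = 0 → IsLeviFlatNear Q p
  nonempty : ∃ p : Fin (n + 1) → ℂ, p 0 ≠ 0 ∧ biEval Q p (star p) = 0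

variable {Q : MvPolynomial (Fin (n + 1) ⊕ Fin (n + 1)) ℂ} {M : Set (Fin (n + 1) → ℂ)}

theorem IsAlgebraicLeviFlat.mem_of_isLeafPoly (H : IsAlgebraicLeviFlat Q M)
    {f : MvPolynomial (Fin (n + 1)) ℂ} (hf : IsLeafPoly Q f) {p : Fin (n + 1) → ℂ} (hp0 : p 0 ≠ 0)
    (hp : eval p f = 0) {z : Fin (n + 1) → ℂ} (hz : z ≠ 0) (hfz : eval z f = 0) : z ∈ M := by
  refine H.mem_of_mem_closure z (closure_mono ?_
    (mem_closure_of_irreducible (g := X 0) hf.irreducible ?_ hfz)) hz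
  · rintro y ⟨hy1, hy2⟩
    rw [eval_X] at hy2
    exact (H.mem_iff y hy2).2 (hf.biEval_eq_zero hy1)
  · rintro ⟨k, hk⟩
    have := congrArg (eval p) hk
    rw [eval_X, map_mul, hp, zero_mul] at this
    exact hp0 this

theorem IsAlgebraicLeviFlat.eval_zero_of_isLeafPoly (H : IsAlgebraicLeviFlat Q M)
    {f : MvPolynomial (Fin (n + 1)) ℂ} (hf : IsLeafPoly Q f) {p : Fin (n + 1) → ℂ} (hp0 : p 0 ≠ 0)
    (hp : eval p f = 0) : eval 0 f = 0 := by
  obtain ⟨D, hD⟩ := H.homogeneous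
  obtain ⟨ν, hν⟩ := H.smooth p hp0 (hf.biEval_eq_zero hp)
  refine eval_zero_of_dvd_homogeneous (hf.dvd_fixSnd p hp) ?_ (D := D) ?_ hp
  · intro h0
    have := eval_dirDeriv_fixSnd p (star p) ν Q
    rw [hν, h0] at this
    simp at this
  · intro t u
    rw [eval_fixSnd, eval_fixSnd, hD]

/-- An algebraic Levi-flat hypersurface contains two distinct irreducible complex hypersurfaces
which meet only at infinity. -/
theorem IsAlgebraicLeviFlat.exists_two_leaves (H : IsAlgebraicLeviFlat Q M) :
    ∃ f g : MvPolynomial (Fin (n + 1)) ℂ, Irreducible f ∧ Irreducible g ∧ ¬ f ∣ g ∧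
      eval 0 f = 0 ∧ eval 0 g = 0 ∧ (∀ z, z ≠ 0 → eval z f = 0 → z ∈ M) ∧
      (∀ z, z ≠ 0 → eval z g = 0 → z ∈ M) ∧ ∀ z, eval z f = 0 → eval z g = 0 → z 0 = 0 := by
  obtain ⟨p, hp0, hpQ⟩ := H.nonempty
  obtain ⟨ν, hν⟩ := H.smooth p hp0 hpQ
  obtain ⟨f, hf, hfp, hfd⟩ := exists_isLeafPoly H.hermitian hpQ hν (H.leviFlat p hp0 hpQ)
  have hev : ∀ᶠ q : Fin (n + 1) → ℂ in 𝓝 p, q 0 ≠ 0 :=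
    (isOpen_ne_fun (continuous_apply 0) continuous_const).mem_nhds hp0
  obtain ⟨q, ⟨hqQ, hfq⟩, hq0⟩ :=
    ((frequently_eval_ne_zero H.hermitian hpQ hν hfp hfd).and_eventually hev).exists
  obtain ⟨μ, hμ⟩ := H.smooth q hq0 hqQ
  obtain ⟨g, hg, hgq, hgd⟩ := exists_isLeafPoly H.hermitian hqQ hμ (H.leviFlat q hq0 hqQ)
  have hgf : ¬ g ∣ f := by
    rintro ⟨k, hk⟩
    rw [hk, map_mul, hgq, zero_mul] at hfq
    exact hfq rfl
  refine ⟨f, g, hf.irreducible, hg.irreducible, fun h => hgf (hf.irreducible.dvd_symm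
    hg.irreducible h), H.eval_zero_of_isLeafPoly hf hp0 hfp, H.eval_zero_of_isLeafPoly hg hq0 hgq,
    fun z => H.mem_of_isLeafPoly hf hp0 hfp, fun z => H.mem_of_isLeafPoly hg hq0 hgq,
    fun z hfz hgz => ?_⟩
  by_contra hz0
  obtain ⟨η, hη⟩ := H.smooth z hz0 (hf.biEval_eq_zero hfz)
  refine not_dvd_fixSnd_mul hη hfz hgz ?_
  obtain ⟨k, hk⟩ := hf.dvd_fixSnd z hfz
  have h2 := hg.dvd_fixSnd z hgz
  rw [hk] at h2 ⊢
  exact mul_dvd_mul_left f ((hg.irreducible.prime.dvd_or_dvd h2).resolve_left hgf)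

end TwoLeaves

section ProjectiveClosure

open MvPolynomial
open scoped Topology ContDiff

variable {n : ℕ} {P : MvPolynomial (Fin n ⊕ Fin n) ℝ}
  {Q : MvPolynomial (Fin (n + 1) ⊕ Fin (n + 1)) ℂ} {D : ℕ}

theorem IsPolarization.realPolyEval_eq_zero_iff (h : IsPolarization P Q D) {z : Fin (n + 1) → ℂ}
    (hz : z 0 ≠ 0) :
    (realPolyEval P fun i => z i.succ / z 0) = 0 ↔ biEval Q z (star z) = 0 := by
  have hs : star (z 0) ≠ 0 := star_ne_zero.2 hz
  rw [h.diag_eval z hz, mul_eq_zero, or_iff_right (pow_ne_zero _ (mul_ne_zero hz hs)),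
    ofReal_eq_zero]

theorem IsPolarization.biEval_eq_zero_of_mem_closure (h : IsPolarization P Q D)
    {z : Fin (n + 1) → ℂ} (hz : z ∈ closure (affineAlgebraicCone P)) :
    biEval Q z (star z) = 0 := by
  have hc : Continuous fun z : Fin (n + 1) → ℂ => biFun Q (z, star z) :=
    (continuous_biFun Q).comp (by fun_prop)
  refine closure_minimal (t := {z | biFun Q (z, star z) = 0}) ?_
    (isClosed_eq hc continuous_const) hz
  rintro w ⟨-, hw0, hw⟩
  exact (h.realPolyEval_eq_zero_iff hw0).1 hw

theorem differentiable_realPolyEval (P : MvPolynomial (Fin n ⊕ Fin n) ℝ) :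
    Differentiable ℝ (realPolyEval P) := by
  unfold realPolyEval
  induction P using MvPolynomial.induction_on with
  | C a => simp
  | add f g hf hg => simpa using hf.fun_add hg
  | mul_X f i hf =>
    simp only [map_mul, eval_X]
    refine hf.fun_mul ?_
    rcases i with i | i
    · exact reCLM.differentiable.comp (differentiable_apply i)
    · exact imCLM.differentiable.comp (differentiable_apply i)

/-- The affine chart `z ↦ (c, c z)`. -/
def affineChart (n : ℕ) (c : ℂ) (z : Fin n → ℂ) : Fin (n + 1) → ℂ := Fin.cons c (c • z)

theorem differentiable_affineChart (c : ℂ) : Differentiable ℝ (affineChart n c) := by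
  rw [differentiable_pi]
  intro i
  induction i using Fin.cases with
  | zero => simp [affineChart]
  | succ i =>
    simp only [affineChart, Fin.cons_succ, Pi.smul_apply]
    fun_prop

theorem IsPolarization.exists_fderiv_eq_one (h : IsPolarization P Q D)
    (hgrad : ∀ z : Fin n → ℂ, realPolyEval P z = 0 → fderiv ℝ (realPolyEval P) z ≠ 0)
    {p : Fin (n + 1) → ℂ} (hp0 : p 0 ≠ 0) (hp : biEval Q p (star p) = 0) :
    ∃ ν, fderiv ℂ (biFun Q) (p, star p) (ν, 0) = 1 := by
  suffices ∃ ν, fderiv ℂ (biFun Q) (p, star p) (ν, 0) ≠ 0 by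
    obtain ⟨ν, hν⟩ := this
    refine ⟨(fderiv ℂ (biFun Q) (p, star p) (ν, 0))⁻¹ • ν, ?_⟩
    have e : ∀ c : ℂ, (c • ν, (0 : Fin (n + 1) → ℂ)) = c • (ν, 0) := by simp
    rw [e, map_smul, smul_eq_mul, inv_mul_cancel₀ hν]
  by_contra! hcon
  have him := IsHermitianPoly.im_eq_zero (Q := Q) h.star_eval
  have hz : fderiv ℝ (diagRe (biFun Q)) p = 0 := by
    ext w
    have e : (w, star w) = (w, (0 : Fin (n + 1) → ℂ)) + ((0 : Fin (n + 1) → ℂ), star w) := by simp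
    rw [fderiv_diagRe (differentiable_biFun Q), e, map_add,
      fderiv_snd_eq_star (differentiable_biFun Q) him, hcon]
    simp
  let a : Fin n → ℂ := fun i => p i.succ / p 0
  have hpa : affineChart n (p 0) a = p := by
    ext i
    induction i using Fin.cases with
    | zero => simp [affineChart]
    | succ i => simp [affineChart, a, mul_div_cancel₀ _ hp0]
  have hcomp : diagRe (biFun Q) ∘ affineChart n (p 0) =
      fun z => normSq (p 0) ^ D * realPolyEval P z := by
    ext z
    have h0 : affineChart n (p 0) z 0 = p 0 := by simp [affineChart]
    have h1 := h.diag_eval (affineChart n (p 0) z) (by rwa [h0])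
    have h2 : (fun i : Fin n => affineChart n (p 0) z i.succ / affineChart n (p 0) z 0) = z := by
      ext i
      simp [affineChart, hp0]
    rw [h2, h0] at h1
    change (biEval Q _ _).re = _
    rw [h1, RCLike.star_def, mul_conj, ← ofReal_pow, ← ofReal_mul, ofReal_re]
  have hdR : DifferentiableAt ℝ (diagRe (biFun Q)) (affineChart n (p 0) a) :=
    (reCLM.differentiable.comp (((differentiable_biFun Q).restrictScalars ℝ).comp
      (conjGraph (n + 1)).differentiable)) _
  have hch := hdR.hasFDerivAt.comp a (differentiable_affineChart (p 0) a).hasFDerivAt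
  rw [hcomp, hpa, hz, ContinuousLinearMap.zero_comp] at hch
  have hne : normSq (p 0) ^ D ≠ 0 := pow_ne_zero _ (normSq_eq_zero.not.2 hp0)
  refine hgrad a ((h.realPolyEval_eq_zero_iff hp0).2 hp) ?_
  have h3 := ((differentiable_realPolyEval P a).hasFDerivAt.const_mul (normSq (p 0) ^ D)).unique hch
  exact (smul_eq_zero.1 h3).resolve_left hne

theorem isAlgebraicLeviFlat_of_isSmoothLeviFlat (h : IsPolarization P Q D)
    (hgrad : ∀ z : Fin n → ℂ, realPolyEval P z = 0 → fderiv ℝ (realPolyEval P) z ≠ 0)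
    (hne : ({w | w ≠ 0 ∧ w ∈ closure (affineAlgebraicCone P)}).Nonempty)
    (hM : IsSmoothLeviFlatHypersurface {w | w ≠ 0 ∧ w ∈ closure (affineAlgebraicCone P)}) :
    IsAlgebraicLeviFlat Q {w | w ≠ 0 ∧ w ∈ closure (affineAlgebraicCone P)} := by
  have hmem : ∀ z : Fin (n + 1) → ℂ, z 0 ≠ 0 →
      (z ∈ {w | w ≠ 0 ∧ w ∈ closure (affineAlgebraicCone P)} ↔ biEval Q z (star z) = 0) := by
    intro z hz
    have hz' : z ≠ 0 := by
      rintro rfl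
      exact hz rfl
    exact ⟨fun hzM => h.biEval_eq_zero_of_mem_closure hzM.2, fun hzQ =>
      ⟨hz', subset_closure ⟨hz', hz, (h.realPolyEval_eq_zero_iff hz).2 hzQ⟩⟩⟩
  refine ⟨h.star_eval, ⟨D, h.smul_eval⟩, hmem, ?_,
    fun p hp0 hp => h.exists_fderiv_eq_one hgrad hp0 hp,
    ?_, ?_⟩
  · intro z hz hz0
    exact ⟨hz0, closure_minimal (fun w hw => hw.2) isClosed_closure hz⟩
  · intro p hp0 hp
    have hev : ∀ᶠ q : Fin (n + 1) → ℂ in 𝓝 p, q 0 ≠ 0 :=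
      (isOpen_ne_fun (continuous_apply 0) continuous_const).mem_nhds hp0
    filter_upwards [hev] with q hq0 hq
    obtain ⟨V, hV, hqV, ρ, hρ, hρd, hρM, hlevi⟩ := hM q ((hmem q hq0).2 hq)
    refine ⟨ρ, ?_, hρd q hqV, ?_, hlevi q hqV ((hρM q hqV).1 ((hmem q hq0).2 hq))⟩
    · exact_mod_cast (hρ 2).contDiffAt (hV.mem_nhds hqV)
    · have hev' : ∀ᶠ q : Fin (n + 1) → ℂ in 𝓝 q, q 0 ≠ 0 :=
        (isOpen_ne_fun (continuous_apply 0) continuous_const).mem_nhds hq0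
      filter_upwards [hV.mem_nhds hqV, hev'] with z hzV hz0 hz
      exact (hρM z hzV).1 ((hmem z hz0).2 hz)
  · obtain ⟨w, -, hw⟩ := hne
    obtain ⟨p, -, hp0, hp⟩ := closure_nonempty_iff.1 ⟨w, hw⟩
    exact ⟨p, hp0, (h.realPolyEval_eq_zero_iff hp0).1 hp⟩

/-- A local `C¹` defining function of a smooth hypersurface. -/
theorem IsSmoothLeviFlatHypersurface.exists_hasStrictFDerivAt {m : ℕ} {M : Set (Fin m → ℂ)}
    (hM : IsSmoothLeviFlatHypersurface M) {r : Fin m → ℂ} (hr : r ∈ M) :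
    ∃ (ρ : (Fin m → ℂ) → ℝ) (L : (Fin m → ℂ) →L[ℝ] ℝ), HasStrictFDerivAt ρ L r ∧ L ≠ 0 ∧
      ∀ᶠ z in 𝓝 r, z ∈ M → ρ z = 0 := by
  obtain ⟨V, hV, hrV, ρ, hρ, hρd, hρM, -⟩ := hM r hr
  refine ⟨ρ, fderiv ℝ ρ r, ?_, hρd r hrV, ?_⟩
  · exact ((hρ 1).contDiffAt (hV.mem_nhds hrV)).hasStrictFDerivAt (by norm_num)
  · filter_upwards [hV.mem_nhds hrV] with z hz hzM
    exact (hρM z hz).1 hzM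

end ProjectiveClosure

section RootFamilies

open scoped Topology

theorem exists_enumeration_roots {p : Polynomial ℂ} {d : ℕ} (hd : p.natDegree = d) :
    ∃ α : Fin d → ℂ, p.roots = Finset.univ.val.map α := by
  have hcard : p.roots.toList.length = d := by
    rw [Multiset.length_toList, ← hd, (IsAlgClosed.splits p).natDegree_eq_card_roots]
  subst hcard
  refine ⟨p.roots.toList.get, ?_⟩
  rw [Fin.univ_val_map, List.ofFn_get, Multiset.coe_toList]

theorem eval_eq_prod_of_roots_eq {p : Polynomial ℂ} {d : ℕ} {α : Fin d → ℂ}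
    (hα : p.roots = Finset.univ.val.map α) (w : ℂ) :
    p.eval w = p.leadingCoeff * ∏ i, (w - α i) := by
  rw [(IsAlgClosed.splits p).eval_eq_prod_roots, hα, Multiset.map_map]
  rfl

/-- Enumerated roots of a continuous family of polynomials with constant leading coefficient
converge along ultrafilters. -/
theorem exists_tendsto_roots {F : ℂ → Polynomial ℂ} {d : ℕ} {c : ℂ} (hc : c ≠ 0)
    (hF : ∀ s, (F s).natDegree = d) (hlc : ∀ s, (F s).leadingCoeff = c)
    (hcont : ∀ k, Continuous fun s => (F s).coeff k) {α : ℂ → Fin d → ℂ}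
    (hα : ∀ s, (F s).roots = Finset.univ.val.map (α s)) {U : Ultrafilter ℂ} (hU : ↑U ≤ 𝓝 (0 : ℂ)) :
    ∃ a : Fin d → ℂ, (∀ i, Filter.Tendsto (fun s => α s i) U (𝓝 (a i))) ∧
      (F 0).roots = Finset.univ.val.map a := by
  have hF0 : ∀ s, F s ≠ 0 := fun s h => hc (by rw [← hlc s, h, Polynomial.leadingCoeff_zero])
  have hbound : ∀ᶠ s in 𝓝 (0 : ℂ), ∀ i, ‖α s i‖ ≤ (F 0).cauchyBound + 1 := by
    have hcb : Continuous fun s => ((F s).cauchyBound : ℝ) := by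
      simp only [Polynomial.cauchyBound, hF, hlc]
      have h1 : Continuous fun s => (Finset.range d).sup fun k => ‖(F s).coeff k‖₊ :=
        Continuous.finset_sup_apply fun k _ => (hcont k).nnnorm
      push_cast
      fun_prop
    have h2 := (isOpen_lt hcb (continuous_const (y := ((F 0).cauchyBound : ℝ) + 1))).mem_nhds
      (show (0 : ℂ) ∈ _ from by simp)
    filter_upwards [h2] with s hs i
    have hroot : (F s).IsRoot (α s i) := by
      refine (Polynomial.mem_roots (hF0 s)).1 ?_
      rw [hα]
      exact Multiset.mem_map_of_mem _ (Finset.mem_univ i)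
    have h3 : ‖α s i‖ < ((F s).cauchyBound : ℝ) :=
      mod_cast hroot.norm_lt_cauchyBound (hF0 s)
    exact h3.le.trans (le_of_lt hs)
  have hlim : ∀ i, ∃ a, Filter.Tendsto (fun s => α s i) U (𝓝 a) := by
    intro i
    have hK := isCompact_closedBall (0 : ℂ) ((F 0).cauchyBound + 1)
    obtain ⟨a, -, ha⟩ := hK.ultrafilter_le_nhds (U.map fun s => α s i) (by
      refine Filter.le_principal_iff.2 ?_
      change (fun s => α s i) ⁻¹' _ ∈ (U : Filter ℂ)
      have h3 : ∀ᶠ s in (U : Filter ℂ), ∀ i, ‖α s i‖ ≤ (F 0).cauchyBound + 1 := hU hbound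
      filter_upwards [h3] with s hs
      simpa using hs i)
    exact ⟨a, ha⟩
  choose a ha using hlim
  refine ⟨a, ha, ?_⟩
  have heval : ∀ w, (F 0).eval w = c * ∏ i, (w - a i) := by
    intro w
    have h1 : Filter.Tendsto (fun s => (F s).eval w) U (𝓝 ((F 0).eval w)) := by
      have : Continuous fun s => (F s).eval w := by
        simp only [Polynomial.eval_eq_sum_range, hF]
        exact continuous_finsetSum _ fun k _ => (hcont k).mul continuous_const
      exact (this.tendsto 0).mono_left hU
    have h2 : Filter.Tendsto (fun s => (F s).eval w) U (𝓝 (c * ∏ i, (w - a i))) := by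
      simp only [eval_eq_prod_of_roots_eq (hα _), hlc]
      exact (tendsto_finsetProd _ fun i _ => (ha i).const_sub w).const_mul c
    exact tendsto_nhds_unique h1 h2
  have hpoly : F 0 = Polynomial.C c *
      ((Finset.univ.val.map a).map fun x => Polynomial.X - Polynomial.C x).prod := by
    refine Polynomial.funext fun w => ?_
    rw [heval, Multiset.map_map, Polynomial.eval_mul, Polynomial.eval_C]
    change _ = c * (∏ i, (Polynomial.X - Polynomial.C (a i))).eval w
    rw [Polynomial.eval_prod]
    simp
  rw [hpoly, Polynomial.roots_C_mul _ hc, Polynomial.roots_multiset_prod_X_sub_C]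

end RootFamilies

section SquaredDirection

open scoped Topology

/-- The square of the direction of a complex number. -/
def sqDir (z : ℂ) : ℂ := z ^ 2 / (‖z‖ : ℂ) ^ 2

theorem sqDir_mul (z w : ℂ) : sqDir (z * w) = sqDir z * sqDir w := by
  simp only [sqDir, norm_mul, ofReal_mul]
  rw [mul_pow, mul_pow, mul_div_mul_comm]

theorem sqDir_pow (z : ℂ) (k : ℕ) : sqDir (z ^ k) = sqDir z ^ k := by
  simp only [sqDir, norm_pow, ofReal_pow, div_pow]
  ring

theorem sqDir_prod {ι : Type*} (s : Finset ι) (f : ι → ℂ) :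
    sqDir (∏ i ∈ s, f i) = ∏ i ∈ s, sqDir (f i) := by
  simp only [sqDir, norm_prod, ofReal_prod, Finset.prod_div_distrib, Finset.prod_pow]

theorem sqDir_ne_zero {z : ℂ} (hz : z ≠ 0) : sqDir z ≠ 0 := by
  have := norm_ne_zero_iff.2 hz
  simp [sqDir, hz]

theorem continuousAt_sqDir {z : ℂ} (hz : z ≠ 0) : ContinuousAt sqDir z := by
  have := norm_ne_zero_iff.2 hz
  unfold sqDir
  refine ContinuousAt.div (by fun_prop) (by fun_prop) ?_
  simpa using hz

/-- The squared direction of a nonzero polynomial has no limit at a zero. -/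
theorem not_tendsto_sqDir_polynomial {p : Polynomial ℂ} (hp : p ≠ 0) (h0 : p.eval 0 = 0) (κ : ℂ) :
    ¬ Filter.Tendsto (fun s => sqDir (p.eval s)) (𝓝[≠] 0) (𝓝 κ) := by
  intro hlim
  obtain ⟨q, hq, hq0⟩ := Polynomial.exists_eq_pow_rootMultiplicity_mul_and_not_dvd p hp 0
  set k := p.rootMultiplicity 0 with hk
  have hk0 : k ≠ 0 := ((Polynomial.rootMultiplicity_pos hp).2 h0).ne'
  have hqe : q.eval 0 ≠ 0 := fun h => hq0 (Polynomial.dvd_iff_isRoot.2 h)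
  have hq1 : Filter.Tendsto (fun s => sqDir (q.eval s)) (𝓝[≠] 0) (𝓝 (sqDir (q.eval 0))) := by
    have := (continuousAt_sqDir hqe).comp_of_eq (f := fun s => q.eval s) (x := (0 : ℂ))
      q.continuous.continuousAt rfl
    exact this.tendsto.mono_left nhdsWithin_le_nhds
  have hpow : Filter.Tendsto (fun s => sqDir s ^ k) (𝓝[≠] 0) (𝓝 (κ / sqDir (q.eval 0))) := by
    refine (hlim.div hq1 (sqDir_ne_zero hqe)).congr' ?_
    have hne : ∀ᶠ s in 𝓝[≠] (0 : ℂ), q.eval s ≠ 0 :=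
      (q.continuous.continuousAt.eventually_ne hqe).filter_mono nhdsWithin_le_nhds
    filter_upwards [hne] with s hs
    have h1 : sqDir (p.eval s) = sqDir s ^ k * sqDir (q.eval s) := by
      conv_lhs => rw [hq]
      simp [sqDir_mul, sqDir_pow]
    simp only [Pi.div_apply, h1]
    rw [mul_div_assoc, div_self (sqDir_ne_zero hs), mul_one]
  have hray : ∀ ω : ℂ, ‖ω‖ = 1 → (ω ^ 2) ^ k = κ / sqDir (q.eval 0) := by
    intro ω hω
    have hω0 : ω ≠ 0 := norm_ne_zero_iff.1 (by rw [hω]; exact one_ne_zero)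
    have ht : Filter.Tendsto (fun t : ℝ => (t : ℂ) * ω) (𝓝[>] 0) (𝓝[≠] 0) := by
      refine tendsto_nhdsWithin_iff.2 ⟨?_, ?_⟩
      · have : Continuous fun t : ℝ => (t : ℂ) * ω := by fun_prop
        have := this.tendsto 0
        rw [ofReal_zero, zero_mul] at this
        exact this.mono_left nhdsWithin_le_nhds
      · filter_upwards [self_mem_nhdsWithin] with t ht
        exact mul_ne_zero (ofReal_ne_zero.2 (ne_of_gt ht)) hω0
    refine tendsto_nhds_unique (tendsto_const_nhds.congr' ?_) (hpow.comp ht)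
    filter_upwards [self_mem_nhdsWithin] with t ht
    have ht' : (t : ℂ) ≠ 0 := ofReal_ne_zero.2 (ne_of_gt ht)
    simp only [Function.comp_apply, sqDir, norm_mul, hω, mul_one, norm_real, Real.norm_eq_abs,
      abs_of_pos (show 0 < t from ht)]
    congr 1
    field_simp
  have h1 := hray 1 (by simp)
  obtain ⟨ω, hω⟩ := IsAlgClosed.exists_pow_nat_eq (-1 : ℂ) (n := 2 * k) (by omega)
  have hωn : ‖ω‖ = 1 := by
    refine (pow_eq_one_iff_of_nonneg (norm_nonneg ω) (n := 2 * k) (by omega)).1 ?_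
    rw [← norm_pow, hω]
    simp
  have h2 := hray ω hωn
  rw [← h1, ← pow_mul, hω] at h2
  norm_num at h2

/-- Two points of a smooth real hypersurface differing by a complex multiple of a transverse
vector and tending to the same point differ asymptotically in a real tangent direction. -/
theorem tendsto_sqDir_of_hypersurface {E ι : Type*} [NormedAddCommGroup E] [NormedSpace ℂ E]
    {ρ : E → ℝ} {L : E →L[ℝ] ℝ} {r v : E} (hρ : HasStrictFDerivAt ρ L r)
    (hv : (L v : ℂ) - L (I • v) * I ≠ 0) {l : Filter ι} {x y : ι → E} {u : ι → ℂ}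
    (hx : Filter.Tendsto x l (𝓝 r)) (hy : Filter.Tendsto y l (𝓝 r))
    (hxy : ∀ᶠ i in l, x i - y i = u i • v) (hu : ∀ᶠ i in l, u i ≠ 0)
    (hρx : ∀ᶠ i in l, ρ (x i) = 0) (hρy : ∀ᶠ i in l, ρ (y i) = 0) :
    Filter.Tendsto (fun i => sqDir (u i)) l
      (𝓝 (-(sqDir ((L v : ℂ) - L (I • v) * I))⁻¹)) := by
  set c : ℂ := (L v : ℂ) - L (I • v) * I with hc
  have hL : ∀ a : ℂ, L (a • v) = (a * c).re := by
    intro a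
    have e : a • v = a.re • v + a.im • (I • v) := by
      conv_lhs => rw [← re_add_im a]
      rw [add_smul, mul_smul]
      rfl
    rw [e, map_add, map_smul, map_smul, hc]
    simp
  have ho := hρ.isLittleO.comp_tendsto (hx.prodMk_nhds hy)
  have ho2 : (fun i => (u i * c).re) =o[l] u := by
    have h3 : (fun i => (u i * c).re) =o[l] fun i => u i • v := by
      refine (ho.neg_left.congr' ?_ ?_)
      · filter_upwards [hxy, hρx, hρy] with i h1 h2 h3
        simp only [Function.comp_apply, h1, h2, h3, hL]
        ring
      · filter_upwards [hxy] with i h1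
        simp [h1]
    refine h3.trans_isBigO (Asymptotics.IsBigO.of_bound ‖v‖
      (Filter.Eventually.of_forall fun i => ?_))
    rw [norm_smul, mul_comm]
  have hre : Filter.Tendsto (fun i => (u i * c).re / ‖u i * c‖) l (𝓝 0) := by
    have h4 := (ho2.norm_right.tendsto_div_nhds_zero).mul_const ‖c‖⁻¹
    rw [zero_mul] at h4
    refine h4.congr fun i => ?_
    rw [norm_mul]
    field_simp
  have hsq : Filter.Tendsto (fun i => sqDir (u i * c) + 1) l (𝓝 0) := by
    have h8 := hre.abs.const_mul 2
    rw [abs_zero, mul_zero] at h8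
    refine squeeze_zero_norm' ?_ h8
    filter_upwards [hu] with i hi
    have hne : u i * c ≠ 0 := mul_ne_zero hi hv
    have hn : (‖u i * c‖ : ℂ) ≠ 0 := ofReal_ne_zero.2 (norm_ne_zero_iff.2 hne)
    have key : sqDir (u i * c) + 1 =
        2 * (((u i * c).re / ‖u i * c‖ : ℝ) : ℂ) * ((u i * c) / ‖u i * c‖) := by
      have h5 : (‖u i * c‖ : ℂ) ^ 2 = (u i * c) * (starRingEnd ℂ) (u i * c) := by
        rw [mul_conj, normSq_eq_norm_sq]
        push_cast
        rfl
      have h6 : (2 * ((u i * c).re : ℂ)) = (u i * c) + (starRingEnd ℂ) (u i * c) := by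
        rw [add_conj]
        push_cast
        rfl
      rw [sqDir, div_add_one (pow_ne_zero 2 hn), ofReal_div, mul_div_assoc', ← mul_div_assoc, h6,
        div_mul_eq_mul_div, div_div, ← sq]
      congr 1
      rw [h5]
      ring
    rw [key, norm_mul, norm_mul, norm_div, norm_real, norm_real, norm_norm, div_self
      (norm_ne_zero_iff.2 hne), mul_one, RCLike.norm_ofNat, Real.norm_eq_abs]
  have hcu : Filter.Tendsto (fun i => sqDir (u i * c)) l (𝓝 (-1)) := by
    simpa using hsq.sub_const 1
  have h7 := hcu.mul_const (sqDir c)⁻¹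
  rw [neg_one_mul] at h7
  refine h7.congr fun i => ?_
  rw [sqDir_mul, mul_assoc, mul_inv_cancel₀ (sqDir_ne_zero hv), mul_one]

end SquaredDirection

section TwoHypersurfaces

open MvPolynomial
open scoped Topology

section ResultantProduct

variable {τ : Type*} {f g : MvPolynomial τ ℂ} {v : τ → ℂ}

theorem eval_lineResultant_eq_prod (hf : eval v (topForm f) ≠ 0) (hg : eval v (topForm g) ≠ 0)
    {y : τ → ℂ} {a : Fin f.totalDegree → ℂ} {b : Fin g.totalDegree → ℂ}
    (ha : ((lineSubst v f).map (eval y)).roots = Finset.univ.val.map a)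
    (hb : ((lineSubst v g).map (eval y)).roots = Finset.univ.val.map b) :
    eval y (lineResultant v f g) = eval v (topForm f) ^ g.totalDegree *
      ∏ i, (eval v (topForm g) * ∏ j, (a i - b j)) := by
  rw [lineResultant, ← Polynomial.resultant_map_map, natDegree_lineSubst_eq hf,
    natDegree_lineSubst_eq hg]
  have h := Polynomial.resultant_eq_prod_eval ((lineSubst v f).map (eval y))
    ((lineSubst v g).map (eval y)) g.totalDegree (natDegree_map_lineSubst_eq hg y).le
    (IsAlgClosed.splits _)
  rw [natDegree_map_lineSubst_eq hf, leadingCoeff_map_lineSubst_eq hf, ha, Multiset.map_map] at h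
  rw [h]
  congr 1
  change ∏ i, _ = _
  refine Finset.prod_congr rfl fun i _ => ?_
  rw [Function.comp_apply, eval_eq_prod_of_roots_eq hb, leadingCoeff_map_lineSubst_eq hg]

theorem exists_roots_lineSubst (hf : eval v (topForm f) ≠ 0) (y : τ → ℂ) :
    ∃ a : Fin f.totalDegree → ℂ,
      ((lineSubst v f).map (eval y)).roots = Finset.univ.val.map a :=
  exists_enumeration_roots (natDegree_map_lineSubst_eq hf y)

theorem eval_eq_zero_of_roots_lineSubst {y : τ → ℂ}
    {a : Fin f.totalDegree → ℂ}
    (ha : ((lineSubst v f).map (eval y)).roots = Finset.univ.val.map a) (i : Fin f.totalDegree) :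
    eval (y + a i • v) f = 0 := by
  rw [← eval_map_lineSubst, eval_eq_prod_of_roots_eq ha,
    Finset.prod_eq_zero (Finset.mem_univ i) (sub_self _), mul_zero]

theorem exists_common_root_of_eval_lineResultant_eq_zero (hf : eval v (topForm f) ≠ 0)
    (hg : eval v (topForm g) ≠ 0) {y : τ → ℂ} (h : eval y (lineResultant v f g) = 0) :
    ∃ w : ℂ, eval (y + w • v) f = 0 ∧ eval (y + w • v) g = 0 := by
  obtain ⟨a, ha⟩ := exists_roots_lineSubst hf y
  obtain ⟨b, hb⟩ := exists_roots_lineSubst hg y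
  rw [eval_lineResultant_eq_prod hf hg ha hb, mul_eq_zero, or_iff_right (pow_ne_zero _ hf),
    Finset.prod_eq_zero_iff] at h
  obtain ⟨i, -, hi⟩ := h
  rw [mul_eq_zero, or_iff_right hg, Finset.prod_eq_zero_iff] at hi
  obtain ⟨j, -, hj⟩ := hi
  refine ⟨a i, eval_eq_zero_of_roots_lineSubst ha i, ?_⟩
  rw [sub_eq_zero.1 hj]
  exact eval_eq_zero_of_roots_lineSubst hb j

/-- A polynomial vanishing at the origin has a zero on a plane minus the origin. -/
theorem exists_eval_smul_add_smul_eq_zero [Fintype τ] {R : MvPolynomial τ ℂ} (hR : eval 0 R = 0)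
    (y₀ y₁ : τ → ℂ) :
    ∃ s t : ℂ, (s ≠ 0 ∨ t ≠ 0) ∧ eval (s • y₀ + t • y₁) R = 0 := by
  by_cases h : ∃ t : ℂ, t ≠ 0 ∧ ((lineSubst y₀ R).map (eval (t • y₁))).degree ≠ 0
  · obtain ⟨t, ht, hd⟩ := h
    obtain ⟨s, hs⟩ := IsAlgClosed.exists_root _ hd
    refine ⟨s, t, Or.inr ht, ?_⟩
    rw [add_comm, ← eval_map_lineSubst]
    exact hs
  · push Not at h
    refine ⟨1, 0, Or.inl one_ne_zero, ?_⟩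
    have h1 : ∀ t : ℂ, t ≠ 0 → eval (t • y₁ + (1 : ℂ) • y₀) R = eval (t • y₁ + (0 : ℂ) • y₀) R := by
      intro t ht
      rw [← eval_map_lineSubst, ← eval_map_lineSubst, Polynomial.eq_C_of_degree_eq_zero (h t ht)]
      simp
    have h2 : Filter.Tendsto (fun t : ℂ => eval (t • y₁ + (1 : ℂ) • y₀) R) (𝓝[≠] 0)
        (𝓝 (eval ((0 : ℂ) • y₁ + (1 : ℂ) • y₀) R)) :=
      (((continuous_eval_mv R).comp (g := fun z => eval z R)
        (f := fun t : ℂ => t • y₁ + (1 : ℂ) • y₀) (by fun_prop)).tendsto 0).mono_left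
        nhdsWithin_le_nhds
    have h3 : Filter.Tendsto (fun t : ℂ => eval (t • y₁ + (0 : ℂ) • y₀) R) (𝓝[≠] 0)
        (𝓝 (eval ((0 : ℂ) • y₁ + (0 : ℂ) • y₀) R)) :=
      (((continuous_eval_mv R).comp (g := fun z => eval z R)
        (f := fun t : ℂ => t • y₁ + (0 : ℂ) • y₀) (by fun_prop)).tendsto 0).mono_left
        nhdsWithin_le_nhds
    have h4 := tendsto_nhds_unique (h2.congr' (by
      filter_upwards [self_mem_nhdsWithin] with t ht using h1 t ht)) h3
    rw [zero_smul, zero_smul, add_zero, zero_add, hR] at h4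
    rw [zero_smul, add_zero]
    exact h4

end ResultantProduct

/-- Two hypersurfaces of dimension at least two through the origin meet elsewhere. -/
theorem exists_ne_zero_common_zero {n : ℕ} (hn : 2 ≤ n) {f g : MvPolynomial (Fin (n + 1)) ℂ}
    (hf : Irreducible f) (hg : g ≠ 0) (hf0 : eval 0 f = 0) (hg0 : eval 0 g = 0) :
    ∃ r : Fin (n + 1) → ℂ, r ≠ 0 ∧ eval r f = 0 ∧ eval r g = 0 := by
  obtain ⟨v, hv⟩ := exists_eval_ne_zero (f := topForm f * topForm g * X 0)
    (mul_ne_zero (mul_ne_zero (topForm_ne_zero hf.ne_zero) (topForm_ne_zero hg)) (X_ne_zero 0))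
  rw [map_mul, map_mul, eval_X, mul_ne_zero_iff, mul_ne_zero_iff] at hv
  obtain ⟨⟨hvf, hvg⟩, hv0⟩ := hv
  have hdeg : (lineSubst v f).natDegree ≠ 0 := by
    rw [natDegree_lineSubst_eq hvf]
    exact totalDegree_ne_zero_of_irreducible hf
  have hR0 : eval 0 (lineResultant v f g) = 0 :=
    eval_lineResultant_eq_zero (w := 0) hdeg (by simpa using hf0) (by simpa using hg0)
  let i₁ : Fin (n + 1) := ⟨1, by omega⟩
  let i₂ : Fin (n + 1) := ⟨2, by omega⟩
  have h10 : (0 : Fin (n + 1)) ≠ i₁ := by simp [i₁, Fin.ext_iff]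
  have h20 : (0 : Fin (n + 1)) ≠ i₂ := by simp [i₂, Fin.ext_iff]
  have h12 : i₁ ≠ i₂ := by simp [i₁, i₂, Fin.ext_iff]
  obtain ⟨s, t, hst, hR⟩ := exists_eval_smul_add_smul_eq_zero hR0 (Pi.single i₁ 1) (Pi.single i₂ 1)
  obtain ⟨w, hwf, hwg⟩ := exists_common_root_of_eval_lineResultant_eq_zero hvf hvg hR
  refine ⟨_, fun h => ?_, hwf, hwg⟩
  have hw : w = 0 := by
    have := congrFun h 0
    simpa [Pi.single_apply, h10, h20, hv0] using this
  subst hw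
  have e1 := congrFun h i₁
  have e2 := congrFun h i₂
  simp [h12] at e1
  simp [h12.symm] at e2
  rcases hst with h | h
  · exact h e1
  · exact h e2

/-- The complex-linear form whose real part is a given real-linear form, as a polynomial. -/
def complexLinearPoly {m : ℕ} (L : (Fin m → ℂ) →L[ℝ] ℝ) : MvPolynomial (Fin m) ℂ :=
  ∑ i, C ((L (Pi.single i 1) : ℂ) - L (I • Pi.single i 1) * I) * X i

theorem eval_complexLinearPoly {m : ℕ} (L : (Fin m → ℂ) →L[ℝ] ℝ) (v : Fin m → ℂ) :
    eval v (complexLinearPoly L) = (L v : ℂ) - L (I • v) * I := by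
  have h1 : ∀ w : Fin m → ℂ, L w = ∑ i, L (Pi.single i (w i)) := by
    intro w
    conv_lhs => rw [← Finset.univ_sum_single w]
    rw [map_sum]
  have h2 : ∀ (i : Fin m) (a : ℂ), L (Pi.single i a) =
      a.re * L (Pi.single i 1) + a.im * L (I • Pi.single i 1) := by
    intro i a
    have e : (Pi.single i a : Fin m → ℂ) =
        a.re • (Pi.single i 1 : Fin m → ℂ) + a.im • (I • Pi.single i 1) := by
      rw [← Pi.single_smul, ← Pi.single_smul, ← Pi.single_smul, ← Pi.single_add]
      congr 1
      apply Complex.ext <;> simp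
    rw [e, map_add, map_smul, map_smul]
    rfl
  rw [complexLinearPoly, map_sum, h1 v, h1 (I • v)]
  push_cast
  rw [Finset.sum_mul, ← Finset.sum_sub_distrib]
  refine Finset.sum_congr rfl fun i _ => ?_
  rw [map_mul, eval_C, eval_X, h2 i (v i), h2 i ((I • v) i)]
  apply Complex.ext <;> simp <;> ring

theorem complexLinearPoly_ne_zero {m : ℕ} {L : (Fin m → ℂ) →L[ℝ] ℝ} (hL : L ≠ 0) :
    complexLinearPoly L ≠ 0 := by
  intro h
  refine hL (ContinuousLinearMap.ext fun v => ?_)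
  have := congrArg re (eval_complexLinearPoly L v)
  rw [h] at this
  simpa using this.symm

theorem continuous_coeff_map_lineSubst {m : ℕ} (v r y : Fin m → ℂ) (f : MvPolynomial (Fin m) ℂ)
    (k : ℕ) : Continuous fun s : ℂ => ((lineSubst v f).map (eval (r + s • y))).coeff k := by
  simp only [Polynomial.coeff_map]
  exact (continuous_eval_mv ((lineSubst v f).coeff k)).comp
    (f := fun s : ℂ => r + s • y) (by fun_prop)

/-- Two distinct irreducible hypersurfaces through the origin contained in a smooth real
hypersurface `M` cannot meet only inside a hyperplane. -/
theorem false_of_irreducible_subset_hypersurface {n : ℕ} (hn : 2 ≤ n)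
    {f g : MvPolynomial (Fin (n + 1)) ℂ} (hf : Irreducible f) (hg : Irreducible g)
    (hfg : ¬ f ∣ g) (hf0 : eval 0 f = 0) (hg0 : eval 0 g = 0) {M : Set (Fin (n + 1) → ℂ)}
    (hfM : ∀ z, z ≠ 0 → eval z f = 0 → z ∈ M) (hgM : ∀ z, z ≠ 0 → eval z g = 0 → z ∈ M)
    (hM : ∀ r ∈ M, ∃ (ρ : (Fin (n + 1) → ℂ) → ℝ) (L : (Fin (n + 1) → ℂ) →L[ℝ] ℝ),
      HasStrictFDerivAt ρ L r ∧ L ≠ 0 ∧ ∀ᶠ z in 𝓝 r, z ∈ M → ρ z = 0)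
    (hcommon : ∀ z, eval z f = 0 → eval z g = 0 → z 0 = 0) : False := by
  obtain ⟨r, hr, hrf, hrg⟩ := exists_ne_zero_common_zero hn hf hg.ne_zero hf0 hg0
  obtain ⟨ρ, L, hρ, hL, hρM⟩ := hM r (hfM r hr hrf)
  obtain ⟨v, hv⟩ := exists_eval_ne_zero (f := topForm f * topForm g * X 0 * complexLinearPoly L)
    (mul_ne_zero (mul_ne_zero (mul_ne_zero (topForm_ne_zero hf.ne_zero)
      (topForm_ne_zero hg.ne_zero)) (X_ne_zero 0)) (complexLinearPoly_ne_zero hL))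
  rw [map_mul, map_mul, map_mul, eval_X, eval_complexLinearPoly, mul_ne_zero_iff, mul_ne_zero_iff,
    mul_ne_zero_iff] at hv
  obtain ⟨⟨⟨hvf, hvg⟩, hv0⟩, hvL⟩ := hv
  have hdeg : (lineSubst v f).natDegree ≠ 0 := by
    rw [natDegree_lineSubst_eq hvf]
    exact totalDegree_ne_zero_of_irreducible hf
  obtain ⟨z, hz⟩ := exists_eval_ne_zero (lineResultant_ne_zero hf hfg hdeg)
  set R := lineResultant v f g with hRdef
  set y := z - r with hy
  set p := (lineSubst y R).map (eval r) with hp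
  have hpe : ∀ s, p.eval s = eval (r + s • y) R := fun s => eval_map_lineSubst y r s R
  have hp1 : p ≠ 0 := by
    intro h
    have := hpe 1
    rw [h, Polynomial.eval_zero, one_smul, hy, add_sub_cancel] at this
    exact hz this.symm
  have hp0 : p.eval 0 = 0 := by
    rw [hpe, zero_smul, add_zero]
    exact eval_lineResultant_eq_zero (w := 0) hdeg (by simpa using hrf) (by simpa using hrg)
  have hpne : ∀ᶠ s in 𝓝[≠] (0 : ℂ), p.eval s ≠ 0 := by
    have hfin := (Polynomial.finite_setOfPred_isRoot hp1).subset (sdiff_subset (t := {0}))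
    rw [eventually_nhdsWithin_iff]
    filter_upwards [hfin.isClosed.isOpen_compl.mem_nhds (fun h => h.2 rfl)] with s hs hs0 h
    exact hs ⟨h, hs0⟩
  choose α hα using fun s : ℂ => exists_roots_lineSubst hvf (r + s • y)
  choose β hβ using fun s : ℂ => exists_roots_lineSubst hvg (r + s • y)
  have hprod : ∀ s, p.eval s = eval v (topForm f) ^ g.totalDegree *
      ∏ i, (eval v (topForm g) * ∏ j, (α s i - β s j)) := fun s => by
    rw [hpe, eval_lineResultant_eq_prod hvf hvg (hα s) (hβ s)]
  set κ₀ : ℂ := -(sqDir ((L v : ℂ) - L (I • v) * I))⁻¹ with hκ₀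
  let κ : ℂ → ℂ → ℂ := fun a b => if a = b then κ₀ else sqDir (a - b)
  let F : ℂ → Polynomial ℂ := fun s => (lineSubst v f).map (eval (r + s • y))
  let G : ℂ → Polynomial ℂ := fun s => (lineSubst v g).map (eval (r + s • y))
  refine not_tendsto_sqDir_polynomial hp1 hp0 (sqDir (eval v (topForm f)) ^ g.totalDegree *
    ((F 0).roots.map fun a => sqDir (eval v (topForm g)) *
      ((G 0).roots.map fun b => κ a b).prod).prod) ?_
  rw [Filter.tendsto_iff_ultrafilter]
  intro U hU
  have hU0 : (U : Filter ℂ) ≤ 𝓝 0 := hU.trans nhdsWithin_le_nhds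
  obtain ⟨a, ha, haF⟩ := exists_tendsto_roots (F := F) hvf
    (fun s => natDegree_map_lineSubst_eq hvf _) (fun s => leadingCoeff_map_lineSubst_eq hvf _)
    (continuous_coeff_map_lineSubst v r y f) hα hU0
  obtain ⟨b, hb, hbG⟩ := exists_tendsto_roots (F := G) hvg
    (fun s => natDegree_map_lineSubst_eq hvg _) (fun s => leadingCoeff_map_lineSubst_eq hvg _)
    (continuous_coeff_map_lineSubst v r y g) hβ hU0
  have hpair : ∀ i j, Filter.Tendsto (fun s => sqDir (α s i - β s j)) U (𝓝 (κ (a i) (b j))) := by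
    intro i j
    by_cases hab : a i = b j
    · have hcomm : a i = 0 := by
        have h1 := eval_eq_zero_of_roots_lineSubst haF i
        have h2 := eval_eq_zero_of_roots_lineSubst hbG j
        rw [← hab] at h2
        have h3 := hcommon _ h1 h2
        have h4 := hcommon _ hrf hrg
        simpa [h4, hv0] using h3
      have hbj : b j = 0 := hab ▸ hcomm
      have hlim : ∀ {γ : ℂ → ℂ}, Filter.Tendsto γ U (𝓝 0) →
          Filter.Tendsto (fun s => r + s • y + γ s • v) U (𝓝 r) := by
        intro γ hγ
        have hid : Filter.Tendsto (fun s : ℂ => s) U (𝓝 0) := hU0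
        have := ((hid.smul_const y).const_add r).add (hγ.smul_const v)
        simpa using this
      have hx := hlim (hcomm ▸ ha i)
      have hy' := hlim (hbj ▸ hb j)
      have hκ : κ (a i) (b j) = κ₀ := if_pos hab
      rw [hκ]
      refine tendsto_sqDir_of_hypersurface hρ hvL hx hy'
        (Filter.Eventually.of_forall fun s => ?_) ?_ ?_ ?_
      · rw [sub_smul]
        abel
      · filter_upwards [hU hpne] with s hs h0
        refine hs ?_
        rw [hprod, Finset.prod_eq_zero (Finset.mem_univ i), mul_zero]
        rw [Finset.prod_eq_zero (Finset.mem_univ j) h0, mul_zero]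
      · filter_upwards [hx.eventually hρM, hx.eventually_ne hr] with s h1 h2
        exact h1 (hfM _ h2 (eval_eq_zero_of_roots_lineSubst (hα s) i))
      · filter_upwards [hy'.eventually hρM, hy'.eventually_ne hr] with s h1 h2
        exact h1 (hgM _ h2 (eval_eq_zero_of_roots_lineSubst (hβ s) j))
    · have hκ : κ (a i) (b j) = sqDir (a i - b j) := if_neg hab
      rw [hκ]
      exact (continuousAt_sqDir (sub_ne_zero.2 hab)).tendsto.comp ((ha i).sub (hb j))
  have hlim : Filter.Tendsto (fun s => sqDir (p.eval s)) U
      (𝓝 (sqDir (eval v (topForm f)) ^ g.totalDegree *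
        ∏ i, (sqDir (eval v (topForm g)) * ∏ j, κ (a i) (b j)))) := by
    simp only [hprod, sqDir_mul, sqDir_pow, sqDir_prod]
    exact (tendsto_finsetProd _ fun i _ =>
      (tendsto_finsetProd _ fun j _ => hpair i j).const_mul _).const_mul _
  rw [haF, hbG]
  simp only [Multiset.map_map, Function.comp_def]
  exact hlim

end TwoHypersurfaces

/-- No smooth real algebraic Levi-flat hypersurface exists in `ℂℙⁿ`, `n ≥ 2`:  the
closure in `ℂℙⁿ` of the zero locus of a real polynomial with nonvanishing gradient is
never a (nonempty) smooth Levi-flat hypersurface. -/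
theorem no_real_algebraic_leviFlat_hypersurface_in_CPn (n : ℕ) (hn : 2 ≤ n)
    (P : MvPolynomial (Fin n ⊕ Fin n) ℝ)
    (hgrad : ∀ z : Fin n → ℂ, realPolyEval P z = 0 → fderiv ℝ (realPolyEval P) z ≠ 0) :
    ¬ (({w | w ≠ 0 ∧ w ∈ closure (affineAlgebraicCone P)}).Nonempty ∧
       IsSmoothLeviFlatHypersurface {w | w ≠ 0 ∧ w ∈ closure (affineAlgebraicCone P)}) := by
  rintro ⟨hne, hM⟩
  obtain ⟨Q, D, h⟩ := exists_isPolarization P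
  obtain ⟨f, g, hf, hg, hfg, hf0, hg0, hfM, hgM, hcommon⟩ :=
    (isAlgebraicLeviFlat_of_isSmoothLeviFlat h hgrad hne hM).exists_two_leaves
  exact false_of_irreducible_subset_hypersurface hn hf hg hfg hf0 hg0 hfM hgM
    (fun r hr => hM.exists_hasStrictFDerivAt hr) hcommon
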